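/- (Pohozaev identity, second identity) Suppose N ≥ 3, f, g : ℝ → ℝ are continuous, and there exist constants C₁, C₂ > 0 such that 0 ≤ t f(t) ≤ C₁(t² + |t|^{2*}) and 0 ≤ t g(t) ≤ C₂(t² + |t|^{2_*}) for all t ∈ ℝ. Let F(t) := ∫₀^t f(s) ds and G(t) := ∫₀^t g(s) ds. Let u ∈ C²(ℝ^N_+) ∩ C¹(closure of ℝ^N_+) satisfy ∫_{ℝ^N_+} K(x)(|∇u|² + u²) dx < ∞, -Δu(x) - (1/2)(x·∇u(x)) = f(u(x)) for all x ∈ ℝ^N_+, and -∂u/∂x_N(x',0) = g(u(x',0)) for all x' ∈ ℝ^{N-1}. Then ((N-2)/2) ∫_{ℝ^N_+} |∇u|² dx - N ∫_{ℝ^N_+} F(u) dx - (N-1) ∫_{ℝ^{N-1}} G(u(x',0)) dx' = -(1/2) ∫_{ℝ^N_+} (x·∇u)² dx. -/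

import Mathlib

open MeasureTheory Real Topology Filter

noncomputable section

/-- `ℝ^N` as Euclidean space. -/
abbrev Euc (N : ℕ) := EuclideanSpace ℝ (Fin N)

/-- Gaussian-type weight `K(x) = exp(|x|²/4)`. -/
noncomputable def Kw {N : ℕ} (x : Euc N) : ℝ := Real.exp (‖x‖ ^ 2 / 4)

/-- critical Sobolev exponent `2* = 2N/(N-2)` -/
noncomputable def twoStar (N : ℕ) : ℝ := 2 * (N : ℝ) / ((N : ℝ) - 2)

/-- critical trace exponent `2_* = 2(N-1)/(N-2)` -/
noncomputable def twoStarL (N : ℕ) : ℝ := 2 * ((N : ℝ) - 1) / ((N : ℝ) - 2)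

/-- `i`-th partial derivative of `u` at `x` -/
noncomputable def pd {N : ℕ} (u : Euc N → ℝ) (i : Fin N) (x : Euc N) : ℝ :=
  fderiv ℝ u x (EuclideanSpace.single i 1)

/-- `|∇u(x)|²` -/
noncomputable def gradSq {N : ℕ} (u : Euc N → ℝ) (x : Euc N) : ℝ :=
  ∑ i, (pd u i x) ^ 2

/-- `x · ∇u(x)` -/
noncomputable def radial {N : ℕ} (u : Euc N → ℝ) (x : Euc N) : ℝ :=
  ∑ i, x i * pd u i x

/-- Laplacian `Δu(x)` -/
noncomputable def lap {N : ℕ} (u : Euc N → ℝ) (x : Euc N) : ℝ :=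
  ∑ i, pd (pd u i) i x

/-- index of the vertical coordinate `x_N` -/
def lastIdx (N : ℕ) (h : 0 < N) : Fin N := ⟨N - 1, by omega⟩

/-- open upper half-space `ℝ^N_+` -/
def upperHS (N : ℕ) (h : 0 < N) : Set (Euc N) := {x | 0 < x (lastIdx N h)}

/-- closed upper half-space -/
def upperHSc (N : ℕ) (h : 0 < N) : Set (Euc N) := {x | 0 ≤ x (lastIdx N h)}

/-- boundary hyperplane `∂ℝ^N_+` -/
def bdryHS (N : ℕ) (h : 0 < N) : Set (Euc N) := {x | x (lastIdx N h) = 0}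

/-- vertical derivative `∂u/∂x_N`, taken within the closed half-space -/
noncomputable def pdN (N : ℕ) (h : 0 < N) (u : Euc N → ℝ) (x : Euc N) : ℝ :=
  fderivWithin ℝ u (upperHSc N h) x (EuclideanSpace.single (lastIdx N h) 1)

/-- embedding of `ℝ^{N-1}` as the boundary of the half-space, `y ↦ (y, 0)` -/
noncomputable def emb (N : ℕ) (y : Euc (N - 1)) : Euc N :=
  (EuclideanSpace.equiv (Fin N) ℝ).symm
    (fun i => if hi : (i : ℕ) < N - 1 then y ⟨(i : ℕ), hi⟩ else 0)

/-- finite weighted energy, i.e. membership in the space `X` -/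
def FiniteEnergy (N : ℕ) (h : 0 < N) (u : Euc N → ℝ) : Prop :=
  IntegrableOn (fun x => Kw x * (gradSq u x + (u x) ^ 2)) (upperHS N h)

/-- classical solution of problem (1.1) -/
structure IsClassicalSolution (N : ℕ) (h : 0 < N) (lam mu p : ℝ) (u : Euc N → ℝ) : Prop where
  smooth2 : ContDiffOn ℝ 2 u (upperHS N h)
  smooth1 : ContDiffOn ℝ 1 u (upperHSc N h)
  pde : ∀ x ∈ upperHS N h,
    -lap u x - (1 / 2) * radial u x
      = lam * |u x| ^ (twoStar N - 2) * u x + mu * |u x| ^ (p - 2) * u x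
  bc : ∀ x ∈ bdryHS N h,
    -pdN N h u x = Real.sqrt lam * |u x| ^ (twoStarL N - 2) * u x

/-- `x_N⁰ = √(N/(N-2))` -/
noncomputable def xN0 (N : ℕ) : ℝ := Real.sqrt ((N : ℝ) / ((N : ℝ) - 2))

/-- `k_N = (N(N-2))^{(N-2)/4}` -/
noncomputable def kN (N : ℕ) : ℝ := ((N : ℝ) * ((N : ℝ) - 2)) ^ (((N : ℝ) - 2) / 4)

/-- `|x'|²`, squared norm of the horizontal part -/
noncomputable def horizSq {N : ℕ} (h : 0 < N) (x : Euc N) : ℝ :=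
  ∑ i ∈ Finset.univ.erase (lastIdx N h), (x i) ^ 2

/-- the family `φ_{ε,τ}` -/
noncomputable def bubbleT (N : ℕ) (h : 0 < N) (ε τ : ℝ) (x : Euc N) : ℝ :=
  (ε * Real.sqrt ((N : ℝ) * ((N : ℝ) - 2)) /
      (ε ^ 2 + horizSq h x + (x (lastIdx N h) + ε * τ * xN0 N) ^ 2)) ^ (((N : ℝ) - 2) / 2)

/-- the boundary bubble `U_ε = φ_{ε,1}` -/
noncomputable def Ubub (N : ℕ) (h : 0 < N) (ε : ℝ) (x : Euc N) : ℝ := bubbleT N h ε 1 x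

/-- `K₁ = ∫_{ℝ^N_+} |∇U_ε|²` (an `ε`-independent constant, computed at `ε = 1`) -/
noncomputable def Kone (N : ℕ) (h : 0 < N) : ℝ :=
  ∫ x in upperHS N h, gradSq (Ubub N h 1) x

/-- `K₂ = ∫_{ℝ^N_+} U_ε^{2*}` -/
noncomputable def Ktwo (N : ℕ) (h : 0 < N) : ℝ :=
  ∫ x in upperHS N h, (Ubub N h 1 x) ^ twoStar N

/-- `K₃ = ∫_{ℝ^{N-1}} U_ε(x',0)^{2_*}` -/
noncomputable def Kthree (N : ℕ) (h : 0 < N) : ℝ :=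
  ∫ y : Euc (N - 1), (Ubub N h 1 (emb N y)) ^ twoStarL N

/-- cut-off function: `φ ∈ C_c^∞(ℝ^N,[0,1])`, `φ ≡ 1` on `B₁(0)`, `φ ≡ 0` outside `B₂(0)` -/
structure IsCutoff (N : ℕ) (φ : Euc N → ℝ) : Prop where
  smooth : ContDiff ℝ (⊤ : ℕ∞) φ
  mem01 : ∀ x, φ x ∈ Set.Icc (0 : ℝ) 1
  eq_one : ∀ x ∈ Metric.closedBall (0 : Euc N) 1, φ x = 1
  eq_zero : ∀ x ∉ Metric.ball (0 : Euc N) 2, φ x = 0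

/-- truncated weighted bubble `Ũ_ε = K^{-1/2} φ U_ε` -/
noncomputable def Ut (N : ℕ) (h : 0 < N) (φ : Euc N → ℝ) (ε : ℝ) (x : Euc N) : ℝ :=
  (Kw x) ^ (-(1 : ℝ) / 2) * φ x * Ubub N h ε x

/-- smooth compactly supported test functions on the closed half-space -/
structure IsTestFun (N : ℕ) (h : 0 < N) (u : Euc N → ℝ) : Prop where
  smooth : ContDiff ℝ (⊤ : ℕ∞) u
  cpt : HasCompactSupport u
  supp : tsupport u ⊆ upperHSc N h

/-- the norm of the space `X`: `‖u‖ = (∫ K |∇u|²)^{1/2}` -/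
noncomputable def Xnorm (N : ℕ) (h : 0 < N) (u : Euc N → ℝ) : ℝ :=
  Real.sqrt (∫ x in upperHS N h, Kw x * gradSq u x)



/-! ### Cutoff functions -/

def phi {n : ℕ} (k : ℕ) (x : Euc n) : ℝ :=
  Real.smoothTransition (2 - ‖x‖ ^ 2 / ((k : ℝ) + 1) ^ 2)

lemma st_deriv_zero {t : ℝ} (ht : t ≤ 0 ∨ 1 ≤ t) : deriv Real.smoothTransition t = 0 := by
  rcases ht with h | h
  · apply IsLocalMin.deriv_eq_zero
    refine Filter.Eventually.of_forall fun y => ?_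
    rw [Real.smoothTransition.zero_of_nonpos h]
    exact Real.smoothTransition.nonneg y
  · apply IsLocalMax.deriv_eq_zero
    refine Filter.Eventually.of_forall fun y => ?_
    rw [Real.smoothTransition.one_of_one_le h]
    exact Real.smoothTransition.le_one y

lemma st_deriv_bound : ∃ L : ℝ, 0 ≤ L ∧ ∀ t, |deriv Real.smoothTransition t| ≤ L := by
  have hc : Continuous (deriv Real.smoothTransition) :=
    (Real.smoothTransition.contDiff (n := 1)).continuous_deriv le_rfl
  obtain ⟨L, hL⟩ := (isCompact_Icc (a := (0 : ℝ)) (b := 1)).exists_bound_of_continuousOn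
    hc.continuousOn
  refine ⟨max L 0, le_max_right _ _, fun t => ?_⟩
  by_cases h : t ≤ 0 ∨ 1 ≤ t
  · rw [st_deriv_zero h]; simp
  · push Not at h
    exact (hL t ⟨h.1.le, h.2.le⟩).trans (le_max_left _ _)

lemma phi_contDiff {n : ℕ} (k : ℕ) : ContDiff ℝ 2 (phi k : Euc n → ℝ) := by
  unfold phi
  exact (Real.smoothTransition.contDiff (n := 2)).comp
    (contDiff_const.sub ((contDiff_norm_sq ℝ).div_const _))

lemma phi_nonneg {n : ℕ} (k : ℕ) (x : Euc n) : 0 ≤ phi k x := Real.smoothTransition.nonneg _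
lemma phi_le_one {n : ℕ} (k : ℕ) (x : Euc n) : phi k x ≤ 1 := Real.smoothTransition.le_one _
lemma phi_abs {n : ℕ} (k : ℕ) (x : Euc n) : |phi k x| ≤ 1 := by
  rw [abs_of_nonneg (phi_nonneg k x)]; exact phi_le_one k x

lemma phi_eq_one {n : ℕ} (k : ℕ) (x : Euc n) (h : ‖x‖ ≤ k + 1) : phi k x = 1 := by
  apply Real.smoothTransition.one_of_one_le
  have : ‖x‖ ^ 2 / ((k : ℝ) + 1) ^ 2 ≤ 1 := by
    rw [div_le_one (by positivity)]
    exact pow_le_pow_left₀ (norm_nonneg _) h 2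
  linarith

lemma phi_eq_zero {n : ℕ} (k : ℕ) (x : Euc n) (h : 2 * ((k : ℝ) + 1) ≤ ‖x‖) : phi k x = 0 := by
  apply Real.smoothTransition.zero_of_nonpos
  have : 2 ≤ ‖x‖ ^ 2 / ((k : ℝ) + 1) ^ 2 := by
    rw [le_div_iff₀ (by positivity)]
    have := pow_le_pow_left₀ (by positivity) h 2
    nlinarith [sq_nonneg ((k : ℝ) + 1)]
  linarith

lemma phi_hcs {n : ℕ} (k : ℕ) : HasCompactSupport (phi k : Euc n → ℝ) := by
  apply HasCompactSupport.of_support_subset_isCompact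
    (isCompact_closedBall (0 : Euc n) (2 * ((k : ℝ) + 1)))
  intro x hx
  rw [mem_closedBall_zero_iff]
  by_contra h
  push Not at h
  exact hx (phi_eq_zero k x h.le)

lemma phi_fderiv {n : ℕ} (k : ℕ) (x v : Euc n) :
    fderiv ℝ (phi k) x v = deriv Real.smoothTransition (2 - ‖x‖ ^ 2 / ((k : ℝ) + 1) ^ 2) *
      (-(2 * inner ℝ x v / ((k : ℝ) + 1) ^ 2)) := by
  have h1 : HasFDerivAt (fun x : Euc n => 2 - ‖x‖ ^ 2 / ((k : ℝ) + 1) ^ 2)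
      (-((((k : ℝ) + 1) ^ 2)⁻¹ • (2 • (innerSL ℝ x)))) x := by
    have := ((hasStrictFDerivAt_norm_sq x).hasFDerivAt.const_mul
      ((((k : ℝ) + 1) ^ 2)⁻¹)).const_sub 2
    refine this.congr_of_eventuallyEq (Eventually.of_forall fun y => ?_)
    simp [div_eq_inv_mul]
  have h2 : HasDerivAt Real.smoothTransition
      (deriv Real.smoothTransition (2 - ‖x‖ ^ 2 / ((k : ℝ) + 1) ^ 2))
      (2 - ‖x‖ ^ 2 / ((k : ℝ) + 1) ^ 2) :=
    ((Real.smoothTransition.contDiff (n := 1)).differentiable (by norm_num) _).hasDerivAt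
  have h3 := h2.comp_hasFDerivAt x h1
  have h4 : fderiv ℝ (phi k) x = _ := h3.fderiv
  rw [h4]
  simp
  left
  ring

lemma phi_fderiv_bound : ∃ C : ℝ, 0 ≤ C ∧ ∀ (n k : ℕ) (x : Euc n),
    ‖fderiv ℝ (phi k) x‖ * (1 + ‖x‖) ≤ C := by
  obtain ⟨L, hL0, hL⟩ := st_deriv_bound
  refine ⟨8 * L, by positivity, fun n k x => ?_⟩
  set r : ℝ := (k : ℝ) + 1 with hr
  have hr1 : 1 ≤ r := by rw [hr]; have : (0 : ℝ) ≤ k := Nat.cast_nonneg k; linarith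
  have hx0 := norm_nonneg x
  have hp : 0 < 1 + ‖x‖ := by positivity
  rw [← le_div_iff₀ hp]
  refine ContinuousLinearMap.opNorm_le_bound _ (by positivity) fun v => ?_
  rw [phi_fderiv, ← hr]
  by_cases h : 2 - ‖x‖ ^ 2 / r ^ 2 ≤ 0 ∨ 1 ≤ 2 - ‖x‖ ^ 2 / r ^ 2
  · rw [st_deriv_zero h]; simp; positivity
  · push Not at h
    obtain ⟨ha, hb⟩ := h
    have ha' : ‖x‖ ^ 2 < 2 * r ^ 2 := by
      rw [← div_lt_iff₀ (by positivity)]; linarith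
    have hb' : r ^ 2 < ‖x‖ ^ 2 := by
      rw [← one_lt_div (by positivity)]; linarith
    have hb2 : r < ‖x‖ := lt_of_pow_lt_pow_left₀ 2 hx0 hb'
    rw [norm_mul, norm_neg, norm_div, norm_mul, Real.norm_eq_abs, norm_pow]
    have hin : ‖inner ℝ x v‖ ≤ ‖x‖ * ‖v‖ := norm_inner_le_norm x v
    have hr2 : ‖r‖ = r := by rw [Real.norm_eq_abs, abs_of_pos (by linarith)]
    rw [hr2]
    have h2 : ‖(2 : ℝ)‖ = 2 := by norm_num
    rw [h2]
    calc _ ≤ L * (2 * (‖x‖ * ‖v‖) / r ^ 2) := by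
          gcongr
          exact hL _
      _ ≤ 8 * L / (1 + ‖x‖) * ‖v‖ := by
          have : 2 * ‖x‖ / r ^ 2 ≤ 8 / (1 + ‖x‖) := by
            rw [div_le_div_iff₀ (by positivity) hp]
            nlinarith
          calc _ = L * ‖v‖ * (2 * ‖x‖ / r ^ 2) := by ring
            _ ≤ L * ‖v‖ * (8 / (1 + ‖x‖)) := by gcongr
            _ = _ := by ring

lemma phi_fderiv_zero {n : ℕ} (k : ℕ) (x : Euc n) (h : ‖x‖ ≤ k + 1) :
    fderiv ℝ (phi k) x = 0 := by
  ext v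
  rw [phi_fderiv, st_deriv_zero]
  · simp
  · right
    have : ‖x‖ ^ 2 / ((k : ℝ) + 1) ^ 2 ≤ 1 := by
      rw [div_le_one (by positivity)]
      exact pow_le_pow_left₀ (norm_nonneg _) h 2
    linarith

lemma ev_norm_le {n : ℕ} (x : Euc n) : ∀ᶠ k : ℕ in atTop, ‖x‖ ≤ (k : ℝ) + 1 := by
  obtain ⟨m, hm⟩ := exists_nat_ge ‖x‖
  filter_upwards [eventually_ge_atTop m] with k hk
  have : (m : ℝ) ≤ k := by exact_mod_cast hk
  linarith

/-! ### Sobolev on the whole space -/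

lemma sobolev_whole (n : ℕ) (hn : 3 ≤ n) (w : Euc n → ℝ) (hw : ContDiff ℝ 1 w)
    (h0 : MemLp w 2 volume) (h1 : MemLp (fderiv ℝ w) 2 volume) :
    MemLp w (ENNReal.ofReal (twoStar n)) volume := by
  have hn' : (3 : ℝ) ≤ n := by exact_mod_cast hn
  refine ⟨hw.continuous.aestronglyMeasurable, ?_⟩
  obtain ⟨C, hC0, hC⟩ := phi_fderiv_bound
  set S := SNormLESNormFDerivOfEqConst ℝ (volume : Measure (Euc n)) 2 with hS
  set B : ENNReal := S * (eLpNorm (fderiv ℝ w) 2 volume + ENNReal.ofReal C * eLpNorm w 2 volume)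
    with hB
  have hBfin : B < ⊤ := by
    apply ENNReal.mul_lt_top ENNReal.coe_lt_top
    exact ENNReal.add_lt_top.2 ⟨h1.2, ENNReal.mul_lt_top ENNReal.ofReal_lt_top h0.2⟩
  have key : ∀ k : ℕ, eLpNorm (fun x => phi k x * w x) (ENNReal.ofReal (twoStar n)) volume ≤ B := by
    intro k
    have hphi : ContDiff ℝ 1 (phi k : Euc n → ℝ) := (phi_contDiff k).of_le (by norm_num)
    have hcd : ContDiff ℝ 1 (fun x => phi k x * w x) := hphi.mul hw
    have hcs : HasCompactSupport (fun x => phi k x * w x) := (phi_hcs k).mul_right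
    have := eLpNorm_le_eLpNorm_fderiv_of_eq (volume : Measure (Euc n)) hcd hcs
      (p := 2) (p' := (twoStar n).toNNReal) (by norm_num) (by simp; omega) (by
        have : 0 ≤ twoStar n := by
          unfold twoStar
          apply div_nonneg <;> linarith
        rw [Real.coe_toNNReal _ this]
        simp [twoStar]
        have : (n : ℝ) ≠ 0 := by linarith
        have : (n : ℝ) - 2 ≠ 0 := by linarith
        field_simp)
    refine this.trans ?_
    rw [hB]
    refine mul_le_mul' (le_of_eq (by simp [hS])) ?_
    have hle : ∀ x, ‖fderiv ℝ (fun x => phi k x * w x) x‖ ≤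
        ‖(‖fderiv ℝ w x‖ + C * ‖w x‖)‖ := by
      intro x
      rw [fderiv_fun_mul (hphi.differentiable (by norm_num) x) (hw.differentiable (by norm_num) x)]
      rw [Real.norm_of_nonneg (by positivity)]
      refine (norm_add_le _ _).trans ?_
      rw [norm_smul, norm_smul]
      have h1 := phi_abs k x
      have h2 : ‖fderiv ℝ (phi k) x‖ ≤ C := by
        have := hC n k x
        nlinarith [norm_nonneg (fderiv ℝ (phi k) x), norm_nonneg x]
      rw [← Real.norm_eq_abs] at h1
      have := mul_le_mul_of_nonneg_right h1 (norm_nonneg (fderiv ℝ w x))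
      have := mul_le_mul_of_nonneg_left h2 (norm_nonneg (w x))
      linarith
    refine (eLpNorm_mono hle).trans ?_
    refine (eLpNorm_add_le h1.1.norm (h0.1.norm.const_mul C) (by norm_num)).trans ?_
    gcongr
    · simp
    · refine (eLpNorm_const_smul_le (c := C) (f := fun x => ‖w x‖)).trans ?_
      rw [eLpNorm_norm, Real.enorm_of_nonneg hC0]
      rfl
  have hlim := Lp.eLpNorm_lim_le_liminf_eLpNorm (μ := (volume : Measure (Euc n)))
    (p := ENNReal.ofReal (twoStar n))
    (f := fun k x => phi k x * w x) (fun k =>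
      ((phi_contDiff k).continuous.mul hw.continuous).aestronglyMeasurable) w
      (Eventually.of_forall fun x => by
        apply tendsto_const_nhds.congr'
        filter_upwards [ev_norm_le x] with k hk
        rw [phi_eq_one k x hk, one_mul])
  refine lt_of_le_of_lt (hlim.trans ?_) hBfin
  exact (liminf_le_liminf (Eventually.of_forall key)).trans (by simp)


/-! ### Half-space basics -/

lemma isOpen_upperHS (N : ℕ) (h : 0 < N) : IsOpen (upperHS N h) := by
  unfold upperHS
  exact isOpen_lt continuous_const (EuclideanSpace.proj (𝕜 := ℝ) (lastIdx N h)).continuous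

lemma isClosed_upperHSc (N : ℕ) (h : 0 < N) : IsClosed (upperHSc N h) := by
  unfold upperHSc
  exact isClosed_le continuous_const (EuclideanSpace.proj (𝕜 := ℝ) (lastIdx N h)).continuous

lemma upperHS_subset (N : ℕ) (h : 0 < N) : upperHS N h ⊆ upperHSc N h := fun x hx => by
  simp only [upperHS, upperHSc, Set.mem_ofPred_eq] at *; exact hx.le

lemma upperHSc_mem_nhds {N : ℕ} {h : 0 < N} {x : Euc N} (hx : x ∈ upperHS N h) :
    upperHSc N h ∈ 𝓝 x :=
  mem_of_superset ((isOpen_upperHS N h).mem_nhds hx) (upperHS_subset N h)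

lemma uniqueDiffOn_upperHSc (N : ℕ) (h : 0 < N) : UniqueDiffOn ℝ (upperHSc N h) := by
  apply uniqueDiffOn_convex
  · unfold upperHSc
    exact convex_halfSpace_ge (EuclideanSpace.proj (𝕜 := ℝ) (lastIdx N h)).toLinearMap.isLinear 0
  · refine ⟨EuclideanSpace.single (lastIdx N h) 1, ?_⟩
    rw [mem_interior_iff_mem_nhds]
    apply upperHSc_mem_nhds
    simp [upperHS]

lemma bdry_null (N : ℕ) (h : 0 < N) : volume (bdryHS N h) = 0 := by
  have := Measure.addHaar_submodule (volume : Measure (Euc N))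
    (LinearMap.ker (EuclideanSpace.proj (𝕜 := ℝ) (lastIdx N h)).toLinearMap) (by
      intro htop
      have : EuclideanSpace.single (lastIdx N h) (1 : ℝ) ∈
        LinearMap.ker (EuclideanSpace.proj (𝕜 := ℝ) (lastIdx N h)).toLinearMap := by
        rw [htop]; trivial
      simp at this)
  convert this using 2
  ext x
  simp [bdryHS]

/-! ### Linear functionals -/

lemma vec_eq_sum {N : ℕ} (v : Euc N) : v = ∑ i, v i • EuclideanSpace.single i (1 : ℝ) := by
  ext j
  simp [Finset.sum_apply, Pi.single_apply]

lemma clm_eq_sum {N : ℕ} (L : Euc N →L[ℝ] ℝ) (v : Euc N) :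
    L v = ∑ i, v i * L (EuclideanSpace.single i 1) := by
  conv_lhs => rw [vec_eq_sum v]
  simp

lemma clm_sq_le {N : ℕ} (L : Euc N →L[ℝ] ℝ) (v : Euc N) :
    (L v) ^ 2 ≤ ‖v‖ ^ 2 * ∑ i, (L (EuclideanSpace.single i 1)) ^ 2 := by
  rw [clm_eq_sum, EuclideanSpace.norm_sq_eq]
  simp only [Real.norm_eq_abs, sq_abs]
  exact Finset.sum_mul_sq_le_sq_mul_sq _ _ _

lemma clm_norm_sq_le {N : ℕ} (L : Euc N →L[ℝ] ℝ) :
    ‖L‖ ^ 2 ≤ ∑ i, (L (EuclideanSpace.single i 1)) ^ 2 := by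
  have h0 : 0 ≤ ∑ i, (L (EuclideanSpace.single i 1)) ^ 2 :=
    Finset.sum_nonneg fun i _ => sq_nonneg _
  have : ‖L‖ ≤ Real.sqrt (∑ i, (L (EuclideanSpace.single i 1)) ^ 2) := by
    refine L.opNorm_le_bound (Real.sqrt_nonneg _) fun v => ?_
    rw [Real.norm_eq_abs]
    apply abs_le_of_sq_le_sq _ (by positivity)
    rw [mul_pow, Real.sq_sqrt h0]
    linarith [clm_sq_le L v]
  calc ‖L‖ ^ 2 ≤ _ := pow_le_pow_left₀ (norm_nonneg _) this 2
    _ = _ := Real.sq_sqrt h0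

lemma radial_eq {N : ℕ} (u : Euc N → ℝ) (x : Euc N) : radial u x = fderiv ℝ u x x := by
  rw [clm_eq_sum]; rfl

/-! ### Reflection extension -/

def hrefl (N : ℕ) (h : 0 < N) (a : ℝ) : Euc N →L[ℝ] Euc N :=
  ContinuousLinearMap.id ℝ (Euc N) -
    (1 + a) • (EuclideanSpace.proj (𝕜 := ℝ) (lastIdx N h)).smulRight
      (EuclideanSpace.single (lastIdx N h) (1 : ℝ))

lemma hrefl_apply (N : ℕ) (h : 0 < N) (a : ℝ) (x : Euc N) :
    hrefl N h a x = x - ((1 + a) * x (lastIdx N h)) • EuclideanSpace.single (lastIdx N h) (1 : ℝ) := by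
  simp [hrefl, smul_smul]

lemma hrefl_last (N : ℕ) (h : 0 < N) (a : ℝ) (x : Euc N) :
    hrefl N h a x (lastIdx N h) = - a * x (lastIdx N h) := by
  rw [hrefl_apply]; simp; ring

lemma hrefl_fix (N : ℕ) (h : 0 < N) (a : ℝ) (x : Euc N) (hx : x (lastIdx N h) = 0) :
    hrefl N h a x = x := by
  rw [hrefl_apply, hx]; simp

lemma hrefl_det (N : ℕ) (h : 0 < N) (a : ℝ) (ha : a ≠ 0) :
    LinearMap.det (hrefl N h a).toLinearMap ≠ 0 := by
  intro h0
  have hc : (hrefl N h a).toLinearMap ∘ₗ (hrefl N h a⁻¹).toLinearMap = LinearMap.id := by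
    apply LinearMap.ext
    intro x
    change hrefl N h a (hrefl N h a⁻¹ x) = x
    rw [hrefl_apply N h a, hrefl_last, hrefl_apply, sub_sub, ← add_smul]
    have : (1 + a⁻¹) * x (lastIdx N h) + (1 + a) * (-a⁻¹ * x (lastIdx N h)) = 0 := by
      field_simp; ring
    rw [this]; simp
  have := congrArg LinearMap.det hc
  rw [LinearMap.det_comp, h0] at this
  simp at this

lemma memLp_comp_hrefl {F : Type*} [NormedAddCommGroup F] (N : ℕ) (h : 0 < N) (a : ℝ) (ha : a ≠ 0)
    (f : Euc N → F) (hf : MemLp f 2 volume) : MemLp (fun x => f (hrefl N h a x)) 2 volume := by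
  have hm : Measure.map (hrefl N h a) (volume : Measure (Euc N)) = _ :=
    Measure.map_linearMap_addHaar_eq_smul_addHaar volume (hrefl_det N h a ha)
  have : MemLp f 2 (Measure.map (hrefl N h a) (volume : Measure (Euc N))) := by
    rw [hm]
    exact hf.smul_measure ENNReal.ofReal_ne_top
  exact this.comp_of_map (hrefl N h a).continuous.measurable.aemeasurable

def lowU (N : ℕ) (h : 0 < N) (u : Euc N → ℝ) (x : Euc N) : ℝ :=
  -3 * u (hrefl N h 1 x) + 4 * u (hrefl N h (1 / 2) x)

def extU (N : ℕ) (h : 0 < N) (u : Euc N → ℝ) (x : Euc N) : ℝ :=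
  open Classical in if x ∈ upperHSc N h then u x else lowU N h u x

def lowD (N : ℕ) (h : 0 < N) (u : Euc N → ℝ) (x : Euc N) : Euc N →L[ℝ] ℝ :=
  (-3 : ℝ) • (fderivWithin ℝ u (upperHSc N h) (hrefl N h 1 x)).comp (hrefl N h 1) +
  (4 : ℝ) • (fderivWithin ℝ u (upperHSc N h) (hrefl N h (1 / 2) x)).comp (hrefl N h (1 / 2))

def extD (N : ℕ) (h : 0 < N) (u : Euc N → ℝ) (x : Euc N) : Euc N →L[ℝ] ℝ :=
  open Classical in if x ∈ upperHSc N h then fderivWithin ℝ u (upperHSc N h) x else lowD N h u x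

def lowHSc (N : ℕ) (h : 0 < N) : Set (Euc N) := {x | x (lastIdx N h) ≤ 0}

lemma isClosed_lowHSc (N : ℕ) (h : 0 < N) : IsClosed (lowHSc N h) := by
  unfold lowHSc
  exact isClosed_le (EuclideanSpace.proj (𝕜 := ℝ) (lastIdx N h)).continuous continuous_const

lemma hrefl_maps (N : ℕ) (h : 0 < N) (a : ℝ) (ha : 0 < a) :
    Set.MapsTo (hrefl N h a) (lowHSc N h) (upperHSc N h) := by
  intro x hx
  simp only [lowHSc, upperHSc, Set.mem_ofPred_eq] at *
  rw [hrefl_last]; nlinarith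

lemma extU_low (N : ℕ) (h : 0 < N) (u : Euc N → ℝ) :
    Set.EqOn (extU N h u) (lowU N h u) (lowHSc N h) := by
  intro x hx
  unfold extU
  split_ifs with hc
  · have h0 : x (lastIdx N h) = 0 := le_antisymm hx hc
    rw [lowU, hrefl_fix _ _ _ _ h0, hrefl_fix _ _ _ _ h0]; ring
  · rfl

lemma extD_low (N : ℕ) (h : 0 < N) (u : Euc N → ℝ) :
    Set.EqOn (extD N h u) (lowD N h u) (lowHSc N h) := by
  intro x hx
  unfold extD
  split_ifs with hc
  · have h0 : x (lastIdx N h) = 0 := le_antisymm hx hc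
    rw [lowD, hrefl_fix _ _ _ _ h0, hrefl_fix _ _ _ _ h0]
    ext v
    simp only [_root_.add_apply, _root_.smul_apply,
      ContinuousLinearMap.comp_apply, hrefl_apply, map_sub, map_smul, smul_eq_mul]
    ring
  · rfl

lemma extU_up (N : ℕ) (h : 0 < N) (u : Euc N → ℝ) : Set.EqOn (extU N h u) u (upperHSc N h) := by
  intro x hx; simp [extU, hx]

lemma extD_up (N : ℕ) (h : 0 < N) (u : Euc N → ℝ) :
    Set.EqOn (extD N h u) (fderivWithin ℝ u (upperHSc N h)) (upperHSc N h) := by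
  intro x hx; simp [extD, hx]

lemma up_union_low (N : ℕ) (h : 0 < N) : upperHSc N h ∪ lowHSc N h = Set.univ := by
  ext x; simp [upperHSc, lowHSc]; exact le_total _ _

lemma lowU_hasFDerivWithinAt (N : ℕ) (h : 0 < N) (u : Euc N → ℝ)
    (h1 : ContDiffOn ℝ 1 u (upperHSc N h)) (x : Euc N) (hx : x ∈ lowHSc N h) :
    HasFDerivWithinAt (lowU N h u) (lowD N h u x) (lowHSc N h) x := by
  have hd : ∀ a : ℝ, 0 < a → HasFDerivWithinAt (fun y => u (hrefl N h a y))
      ((fderivWithin ℝ u (upperHSc N h) (hrefl N h a x)).comp (hrefl N h a)) (lowHSc N h) x := by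
    intro a ha
    have hu := (h1.differentiableOn (by norm_num) _ (hrefl_maps N h a ha hx)).hasFDerivWithinAt
    exact hu.comp x (hrefl N h a).hasFDerivWithinAt (hrefl_maps N h a ha)
  exact ((hd 1 one_pos).const_mul (-3)).add ((hd (1 / 2) (by norm_num)).const_mul 4)

lemma not_mem_closure_hasFDerivWithinAt {E : Type*} [NormedAddCommGroup E] [NormedSpace ℝ E]
    {f : E → ℝ} {f' : E →L[ℝ] ℝ} {s : Set E} {x : E} (hs : IsClosed s) (hx : x ∉ s) :
    HasFDerivWithinAt f f' s x :=
  HasFDerivWithinAt.of_notMem_closure (by rwa [hs.closure_eq])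

lemma extU_hasFDerivAt (N : ℕ) (h : 0 < N) (u : Euc N → ℝ)
    (h1 : ContDiffOn ℝ 1 u (upperHSc N h)) (x : Euc N) :
    HasFDerivAt (extU N h u) (extD N h u x) x := by
  rw [← hasFDerivWithinAt_univ, ← up_union_low N h]
  apply HasFDerivWithinAt.union
  · by_cases hx : x ∈ upperHSc N h
    · rw [extD_up N h u hx]
      exact ((h1.differentiableOn (by norm_num) x hx).hasFDerivWithinAt).congr (extU_up N h u)
        (extU_up N h u hx)
    · exact not_mem_closure_hasFDerivWithinAt (isClosed_upperHSc N h) hx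
  · by_cases hx : x ∈ lowHSc N h
    · rw [extD_low N h u hx]
      exact (lowU_hasFDerivWithinAt N h u h1 x hx).congr (extU_low N h u)
        (extU_low N h u hx)
    · exact not_mem_closure_hasFDerivWithinAt (isClosed_lowHSc N h) hx

lemma gradW_cont (N : ℕ) (h : 0 < N) (u : Euc N → ℝ)
    (h1 : ContDiffOn ℝ 1 u (upperHSc N h)) :
    ContinuousOn (fderivWithin ℝ u (upperHSc N h)) (upperHSc N h) :=
  h1.continuousOn_fderivWithin (uniqueDiffOn_upperHSc N h) le_rfl

lemma extD_continuous (N : ℕ) (h : 0 < N) (u : Euc N → ℝ)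
    (h1 : ContDiffOn ℝ 1 u (upperHSc N h)) : Continuous (extD N h u) := by
  rw [← continuousOn_univ, ← up_union_low N h]
  have hc := gradW_cont N h u h1
  apply ContinuousOn.union_of_isClosed _ _ (isClosed_upperHSc N h) (isClosed_lowHSc N h)
  · exact hc.congr (extD_up N h u)
  · refine ContinuousOn.congr ?_ (extD_low N h u)
    have hd : ∀ a : ℝ, 0 < a → ContinuousOn (fun y =>
      ((fderivWithin ℝ u (upperHSc N h) (hrefl N h a y)).comp (hrefl N h a))) (lowHSc N h) := by
      intro a ha
      exact (hc.comp (hrefl N h a).continuous.continuousOn (hrefl_maps N h a ha)).clm_comp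
        continuousOn_const
    exact ((hd 1 one_pos).const_smul (-3 : ℝ)).add ((hd (1 / 2) (by norm_num)).const_smul (4 : ℝ))

lemma extU_contDiff (N : ℕ) (h : 0 < N) (u : Euc N → ℝ)
    (h1 : ContDiffOn ℝ 1 u (upperHSc N h)) : ContDiff ℝ 1 (extU N h u) := by
  rw [contDiff_one_iff_fderiv]
  refine ⟨fun x => (extU_hasFDerivAt N h u h1 x).differentiableAt, ?_⟩
  have : fderiv ℝ (extU N h u) = extD N h u := by
    ext1 x; exact (extU_hasFDerivAt N h u h1 x).fderiv
  rw [this]; exact extD_continuous N h u h1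

lemma hrefl_mem (N : ℕ) (h : 0 < N) (a : ℝ) (ha : 0 < a) (x : Euc N) :
    hrefl N h a x ∈ upperHS N h ↔ x (lastIdx N h) < 0 := by
  simp only [upperHS, Set.mem_ofPred_eq, hrefl_last]
  constructor
  · intro hh; nlinarith
  · intro hh; nlinarith

lemma ae_not_bdry (N : ℕ) (h : 0 < N) : ∀ᵐ x : Euc N, x (lastIdx N h) ≠ 0 := by
  have := bdry_null N h
  rw [ae_iff]
  simpa [bdryHS] using this

lemma extU_memLp (N : ℕ) (h : 0 < N) (u : Euc N → ℝ)
    (hu : MemLp u 2 (volume.restrict (upperHS N h)))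
    :
    MemLp (extU N h u) 2 volume := by
  have hHm := (isOpen_upperHS N h).measurableSet
  have hi0 : MemLp ((upperHS N h).indicator u) 2 volume := (memLp_indicator_iff_restrict hHm).2 hu
  have A := (hi0.add (((memLp_comp_hrefl N h 1 one_ne_zero _ hi0).const_mul (-3)).add
    ((memLp_comp_hrefl N h (1 / 2) (by norm_num) _ hi0).const_mul 4)))
  refine A.ae_eq ?_
  filter_upwards [ae_not_bdry N h] with x hx
  simp only [Pi.add_apply]
  rcases lt_or_gt_of_ne hx with hx | hx
  · have e1 := (hrefl_mem N h 1 one_pos x).2 hx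
    have e2 := (hrefl_mem N h (1 / 2) (by norm_num) x).2 hx
    have e3 : x ∉ upperHS N h := by simp only [upperHS, Set.mem_ofPred_eq]; linarith
    rw [Set.indicator_of_mem e1, Set.indicator_of_mem e2, Set.indicator_of_notMem e3,
      extU_low N h u (show x ∈ lowHSc N h from hx.le), lowU]
    ring
  · have e1 : hrefl N h 1 x ∉ upperHS N h := by
      rw [hrefl_mem N h 1 one_pos x]; linarith
    have e2 : hrefl N h (1 / 2) x ∉ upperHS N h := by
      rw [hrefl_mem N h (1 / 2) (by norm_num) x]; linarith
    have e3 : x ∈ upperHS N h := hx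
    rw [Set.indicator_of_notMem e1, Set.indicator_of_notMem e2, Set.indicator_of_mem e3,
      extU_up N h u (upperHS_subset N h e3)]
    ring

def indD (N : ℕ) (h : 0 < N) (u : Euc N → ℝ) (x : Euc N) : ℝ :=
  (upperHS N h).indicator (fun y => ‖fderiv ℝ u y‖) x

lemma indD_nonneg (N : ℕ) (h : 0 < N) (u : Euc N → ℝ) (x : Euc N) : 0 ≤ indD N h u x :=
  Set.indicator_nonneg (fun _ _ => norm_nonneg _) x

lemma extD_bound (N : ℕ) (h : 0 < N) (u : Euc N → ℝ) (x : Euc N) (hx : x (lastIdx N h) ≠ 0) :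
    ‖extD N h u x‖ ≤ indD N h u x + (3 * ‖hrefl N h 1‖ * indD N h u (hrefl N h 1 x) +
      4 * ‖hrefl N h (1 / 2)‖ * indD N h u (hrefl N h (1 / 2) x)) := by
  have hw : ∀ y ∈ upperHS N h, fderivWithin ℝ u (upperHSc N h) y = fderiv ℝ u y := fun y hy =>
    fderivWithin_of_mem_nhds (upperHSc_mem_nhds hy)
  rcases lt_or_gt_of_ne hx with hx | hx
  · have e1 := (hrefl_mem N h 1 one_pos x).2 hx
    have e2 := (hrefl_mem N h (1 / 2) (by norm_num) x).2 hx
    have e3 : x ∉ upperHS N h := by simp only [upperHS, Set.mem_ofPred_eq]; linarith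
    have i1 : indD N h u (hrefl N h 1 x) = ‖fderiv ℝ u (hrefl N h 1 x)‖ :=
      Set.indicator_of_mem e1 _
    have i2 : indD N h u (hrefl N h (1 / 2) x) = ‖fderiv ℝ u (hrefl N h (1 / 2) x)‖ :=
      Set.indicator_of_mem e2 _
    rw [i1, i2, extD_low N h u (show x ∈ lowHSc N h from hx.le), lowD, hw _ e1, hw _ e2]
    refine (norm_add_le _ _).trans ?_
    rw [norm_smul, norm_smul, show ‖(-3 : ℝ)‖ = 3 by norm_num, show ‖(4 : ℝ)‖ = 4 by norm_num]
    have k1 := ContinuousLinearMap.opNorm_comp_le (fderiv ℝ u (hrefl N h 1 x)) (hrefl N h 1)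
    have k2 := ContinuousLinearMap.opNorm_comp_le (fderiv ℝ u (hrefl N h (1 / 2) x))
      (hrefl N h (1 / 2))
    have k3 := indD_nonneg N h u x
    linarith
  · have e3 : x ∈ upperHS N h := hx
    have i3 : indD N h u x = ‖fderiv ℝ u x‖ := Set.indicator_of_mem e3 _
    rw [extD_up N h u (upperHS_subset N h e3), hw x e3, i3]
    have k1 := mul_nonneg (mul_nonneg (zero_le_three (α := ℝ)) (norm_nonneg (hrefl N h 1)))
      (indD_nonneg N h u (hrefl N h 1 x))
    have k2 := mul_nonneg (mul_nonneg (zero_le_four (α := ℝ)) (norm_nonneg (hrefl N h (1 / 2))))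
      (indD_nonneg N h u (hrefl N h (1 / 2) x))
    linarith

lemma extD_memLp (N : ℕ) (h : 0 < N) (u : Euc N → ℝ)
    (h1 : ContDiffOn ℝ 1 u (upperHSc N h))
    (hdu : MemLp (fderiv ℝ u) 2 (volume.restrict (upperHS N h))) :
    MemLp (fderiv ℝ (extU N h u)) 2 volume := by
  have hHm := (isOpen_upperHS N h).measurableSet
  have hi1 : MemLp (indD N h u) 2 volume :=
    (memLp_indicator_iff_restrict hHm).2 hdu.norm
  have hfd : fderiv ℝ (extU N h u) = extD N h u := by
    ext1 x; exact (extU_hasFDerivAt N h u h1 x).fderiv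
  rw [hfd]
  have B1 : MemLp (fun x => 3 * ‖hrefl N h 1‖ * indD N h u (hrefl N h 1 x)) 2 volume :=
    (memLp_comp_hrefl N h 1 one_ne_zero _ hi1).const_mul _
  have B2 : MemLp (fun x => 4 * ‖hrefl N h (1 / 2)‖ * indD N h u (hrefl N h (1 / 2) x)) 2 volume :=
    (memLp_comp_hrefl N h (1 / 2) (by norm_num) _ hi1).const_mul _
  have A := hi1.add (B1.add B2)
  refine A.mono (extD_continuous N h u h1).aestronglyMeasurable ?_
  filter_upwards [ae_not_bdry N h] with x hx
  exact (extD_bound N h u x hx).trans (le_abs_self _)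

lemma sobolev_half (N : ℕ) (hN : 3 ≤ N) (h : 0 < N) (u : Euc N → ℝ)
    (h1 : ContDiffOn ℝ 1 u (upperHSc N h))
    (hu : MemLp u 2 (volume.restrict (upperHS N h)))
    (hdu : MemLp (fderiv ℝ u) 2 (volume.restrict (upperHS N h))) :
    MemLp u (ENNReal.ofReal (twoStar N)) (volume.restrict (upperHS N h)) := by
  have hHm := (isOpen_upperHS N h).measurableSet
  have := sobolev_whole N hN _ (extU_contDiff N h u h1) (extU_memLp N h u hu) (extD_memLp N h u h1 hdu)
  refine (this.restrict (upperHS N h)).ae_eq ?_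
  filter_upwards [ae_restrict_mem hHm] with x hx
  exact extU_up N h u (upperHS_subset N h hx)


/-! ### Divergence theorem on the half-space -/

lemma abs_coord_le {N : ℕ} (x : Euc N) (i : Fin N) : |x i| ≤ ‖x‖ := by
  have := PiLp.norm_apply_le x i
  rwa [Real.norm_eq_abs] at this

lemma emb_toLp (n : ℕ) (z : Fin n → ℝ) :
    emb (n + 1) (WithLp.toLp 2 z : Euc n) =
      (WithLp.toLp 2 ((Fin.last n).insertNth (0 : ℝ) z : Fin (n + 1) → ℝ) : Euc (n + 1)) := by
  ext i
  refine Fin.lastCases ?_ (fun j => ?_) i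
  · simp [emb]
  · have : (Fin.last n).insertNth (α := fun _ => ℝ) (0 : ℝ) z (j.castSucc) = z j := by
      rw [← Fin.succAbove_last_apply, Fin.insertNth_apply_succAbove]
    simp [emb, this]

lemma div_half (n : ℕ) (h : 0 < n + 1) (V Vb : Fin (n + 1) → Euc (n + 1) → ℝ) (M : ℝ) (hM : 0 < M)
    (hcont : ∀ i, ContinuousOn (Vb i) (upperHSc (n + 1) h))
    (heq : ∀ i, Set.EqOn (V i) (Vb i) (upperHS (n + 1) h))
    (hd : ∀ i, ∀ x ∈ upperHS (n + 1) h, DifferentiableAt ℝ (V i) x)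
    (hz : ∀ i x, M ≤ ‖x‖ → Vb i x = 0)
    (D : Euc (n + 1) → ℝ) (hD : ∀ x ∈ upperHS (n + 1) h, ∑ i, pd (V i) i x = D x)
    (hIntg : IntegrableOn D (upperHS (n + 1) h)) :
    ∫ x in upperHS (n + 1) h, D x = - ∫ y : Euc n, Vb (Fin.last n) (emb (n + 1) y) := by
  have hlast : lastIdx (n + 1) h = Fin.last n := rfl
  set a : Fin (n + 1) → ℝ := fun i => if i = Fin.last n then 0 else -(M + 1) with ha
  set b : Fin (n + 1) → ℝ := fun _ => M + 1 with hb
  have hab : a ≤ b := by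
    intro i; simp only [ha, hb]; split_ifs <;> linarith
  let T : (Fin (n + 1) → ℝ) →L[ℝ] Euc (n + 1) :=
    ((EuclideanSpace.equiv (Fin (n + 1)) ℝ).symm : (Fin (n + 1) → ℝ) →L[ℝ] Euc (n + 1))
  have hT : ∀ z, T z = WithLp.toLp 2 z := fun z => rfl
  have hTi : ∀ z i, (T z) i = z i := fun z i => rfl
  have hTs : ∀ i, T (Pi.single i 1) = EuclideanSpace.single i 1 := fun i => rfl
  have hev : ∀ i, ∀ x ∈ upperHS (n + 1) h, V i =ᶠ[𝓝 x] Vb i := fun i x hx =>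
    (heq i).eventuallyEq_of_mem ((isOpen_upperHS (n + 1) h).mem_nhds hx)
  set P : Set (Fin (n + 1) → ℝ) := WithLp.toLp 2 ⁻¹' (upperHS (n + 1) h) with hP
  have hPm : MeasurableSet P :=
    (PiLp.continuous_toLp 2 _).measurable (isOpen_upperHS (n + 1) h).measurableSet
  have hmp := PiLp.volume_preserving_toLp (Fin (n + 1))
  have hme : MeasurableEmbedding (WithLp.toLp 2 : (Fin (n + 1) → ℝ) → Euc (n + 1)) :=
    (MeasurableEquiv.toLp 2 (Fin (n + 1) → ℝ)).measurableEmbedding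
  set f' : Fin (n + 1) → (Fin (n + 1) → ℝ) → ((Fin (n + 1) → ℝ) →L[ℝ] ℝ) :=
    fun i z => (fderiv ℝ (V i) (T z)).comp T with hf'
  set S : (Fin (n + 1) → ℝ) → ℝ := fun z => ∑ i, f' i z (Pi.single i 1) with hS
  have hSP : ∀ z ∈ P, S z = D (WithLp.toLp 2 z) := by
    intro z hz
    rw [← hD _ hz]
    simp only [hS, hf', ContinuousLinearMap.comp_apply, hTs, pd]
    rfl
  have hnull : volume {z : Fin (n + 1) → ℝ | z (Fin.last n) = 0} = 0 := by
    have hmeas : MeasurableSet (bdryHS (n + 1) h) := by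
      unfold bdryHS
      exact (isClosed_eq (EuclideanSpace.proj (𝕜 := ℝ) _).continuous
        continuous_const).measurableSet
    have := hmp.measure_preimage hmeas.nullMeasurableSet
    rw [bdry_null] at this
    exact this
  have hIccP : (Set.Icc a b ∩ P : Set _) =ᵐ[volume] Set.Icc a b := by
    have : ∀ᵐ z : Fin (n + 1) → ℝ, z (Fin.last n) ≠ 0 := by
      rw [ae_iff]; simpa using hnull
    filter_upwards [this] with z hz
    apply propext
    constructor
    · exact fun hh => hh.1
    · intro hh
      refine ⟨hh, ?_⟩
      have h0 : a (Fin.last n) ≤ z (Fin.last n) := hh.1 _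
      simp only [ha, if_true] at h0
      exact lt_of_le_of_ne h0 (Ne.symm hz)
  have hDP : IntegrableOn (fun z => D (WithLp.toLp 2 z)) P :=
    (hmp.integrableOn_comp_preimage hme).2 hIntg
  have hIP : MeasurableSet (Set.Icc a b ∩ P) := measurableSet_Icc.inter hPm
  have hSint : IntegrableOn S (Set.Icc a b) := by
    refine IntegrableOn.congr_set_ae ?_ hIccP.symm
    refine IntegrableOn.congr_fun (hDP.mono_set Set.inter_subset_right) ?_ hIP
    intro z hz
    exact (hSP z hz.2).symm
  have key := integral_divergence_of_hasFDerivAt_off_countable' a b hab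
    (fun i z => Vb i (T z)) f' ∅ Set.countable_empty
    (fun i => (hcont i).comp T.continuous.continuousOn (by
      intro z hz
      have h0 : a (Fin.last n) ≤ z (Fin.last n) := hz.1 _
      simp only [ha, if_true] at h0
      exact h0))
    (by
      intro z hz i
      have h0 : a (Fin.last n) < z (Fin.last n) := (hz.1 _ (Set.mem_univ _)).1
      simp only [ha, if_true] at h0
      have hzH : T z ∈ upperHS (n + 1) h := h0
      have h1 := (hd i _ hzH).hasFDerivAt.congr_of_eventuallyEq (hev i _ hzH).symm
      exact h1.comp z T.hasFDerivAt)
    hSint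
  have hL : ∫ z in Set.Icc a b, S z = ∫ x in upperHS (n + 1) h, D x := by
    rw [← setIntegral_congr_set hIccP, setIntegral_congr_fun hIP (fun z hz => hSP z hz.2),
      ← hmp.setIntegral_preimage_emb hme]
    symm
    apply setIntegral_eq_of_subset_of_forall_sdiff_eq_zero hPm Set.inter_subset_right
    rintro z ⟨hzP, hz2⟩
    have hzI : z ∉ Set.Icc a b := fun hh => hz2 ⟨hh, hzP⟩
    have hzP' : 0 < z (Fin.last n) := hzP
    have hbig : M < ‖(WithLp.toLp 2 z : Euc (n + 1))‖ := by
      by_contra hle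
      push Not at hle
      apply hzI
      constructor
      · intro i
        have := abs_le.1 (abs_coord_le (WithLp.toLp 2 z : Euc (n + 1)) i)
        simp only at this
        simp only [ha]
        split_ifs with hi
        · rw [hi]; exact hzP'.le
        · linarith [this.1]
      · intro i
        have := abs_le.1 (abs_coord_le (WithLp.toLp 2 z : Euc (n + 1)) i)
        simp only at this
        simp only [hb]
        linarith [this.2]
    rw [← hD _ hzP]
    apply Finset.sum_eq_zero
    intro i _
    have e1 : V i =ᶠ[𝓝 (WithLp.toLp 2 z : Euc (n + 1))] fun _ => (0 : ℝ) := by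
      refine (hev i _ hzP).trans ?_
      have : ∀ᶠ x : Euc (n + 1) in 𝓝 (WithLp.toLp 2 z), M < ‖x‖ :=
        continuous_norm.continuousAt.eventually_const_lt hbig
      filter_upwards [this] with x hx using hz i x hx.le
    rw [pd, e1.fderiv_eq]
    simp
  rw [← hL, key, Finset.sum_eq_single (Fin.last n)]
  · rw [setIntegral_eq_zero_of_forall_eq_zero]
    · rw [zero_sub]
      congr 1
      rw [setIntegral_eq_integral_of_forall_compl_eq_zero]
      · rw [← (PiLp.volume_preserving_toLp (Fin n)).integral_comp
          (MeasurableEquiv.toLp 2 (Fin n → ℝ)).measurableEmbedding]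
        congr 1
        ext z
        rw [emb_toLp, hT]
        simp [ha]
      · intro z hzI
        apply hz
        by_contra hle
        push Not at hle
        apply hzI
        have hj : ∀ j : Fin n, |z j| ≤ M := by
          intro j
          have := abs_coord_le (T ((Fin.last n).insertNth (a (Fin.last n)) z))
            ((Fin.last n).succAbove j)
          rw [hTi, Fin.insertNth_apply_succAbove] at this
          linarith
        constructor
        · intro j
          simp only [ha, Function.comp, Fin.succAbove_ne, if_false]
          linarith [(abs_le.1 (hj j)).1]
        · intro j
          simp only [hb, Function.comp]
          linarith [(abs_le.1 (hj j)).2]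
    · intro z _
      apply hz
      have := abs_coord_le (T ((Fin.last n).insertNth (b (Fin.last n)) z)) (Fin.last n)
      rw [hTi, Fin.insertNth_apply_same] at this
      simp only [hb] at this ⊢
      linarith [le_abs_self (M + 1)]
  · intro i _ hi
    rw [setIntegral_eq_zero_of_forall_eq_zero, setIntegral_eq_zero_of_forall_eq_zero, sub_zero]
    · intro z _
      apply hz
      have := abs_coord_le (T (i.insertNth (a i) z)) i
      rw [hTi, Fin.insertNth_apply_same] at this
      simp only [ha, hi, if_false] at this ⊢
      rw [abs_neg] at this
      linarith [le_abs_self (M + 1)]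
    · intro z _
      apply hz
      have := abs_coord_le (T (i.insertNth (b i) z)) i
      rw [hTi, Fin.insertNth_apply_same] at this
      simp only [hb] at this ⊢
      linarith [le_abs_self (M + 1)]
  · simp


/-! ### Partial derivative calculus -/

lemma pd_mul {N : ℕ} {a b : Euc N → ℝ} {x : Euc N} (i : Fin N) (ha : DifferentiableAt ℝ a x)
    (hb : DifferentiableAt ℝ b x) :
    pd (fun y => a y * b y) i x = pd a i x * b x + a x * pd b i x := by
  unfold pd
  rw [fderiv_fun_mul ha hb]
  simp; ring

lemma pd_add {N : ℕ} {a b : Euc N → ℝ} {x : Euc N} (i : Fin N) (ha : DifferentiableAt ℝ a x)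
    (hb : DifferentiableAt ℝ b x) :
    pd (fun y => a y + b y) i x = pd a i x + pd b i x := by
  unfold pd
  rw [fderiv_fun_add ha hb]
  simp

lemma pd_sub {N : ℕ} {a b : Euc N → ℝ} {x : Euc N} (i : Fin N) (ha : DifferentiableAt ℝ a x)
    (hb : DifferentiableAt ℝ b x) :
    pd (fun y => a y - b y) i x = pd a i x - pd b i x := by
  unfold pd
  rw [fderiv_fun_sub ha hb]
  simp

lemma pd_sum {N : ℕ} {a : Fin N → Euc N → ℝ} {x : Euc N} (i : Fin N)
    (ha : ∀ j, DifferentiableAt ℝ (a j) x) :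
    pd (fun y => ∑ j, a j y) i x = ∑ j, pd (a j) i x := by
  unfold pd
  rw [fderiv_fun_sum (fun j _ => ha j)]
  simp

lemma coord_diff {N : ℕ} (j : Fin N) (x : Euc N) : DifferentiableAt ℝ (fun y : Euc N => y j) x :=
  (EuclideanSpace.proj (𝕜 := ℝ) j).differentiableAt

lemma pd_coord {N : ℕ} (i j : Fin N) (x : Euc N) :
    pd (fun y : Euc N => y j) i x = if j = i then 1 else 0 := by
  unfold pd
  have : fderiv ℝ (fun y : Euc N => y j) x = EuclideanSpace.proj (𝕜 := ℝ) j :=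
    (EuclideanSpace.proj (𝕜 := ℝ) j).fderiv
  rw [this]
  simp [Pi.single_apply]

lemma pd_comp {N : ℕ} {F : ℝ → ℝ} {F' : ℝ} {u : Euc N → ℝ} {x : Euc N} (i : Fin N)
    (hF : HasDerivAt F F' (u x)) (hu : DifferentiableAt ℝ u x) :
    pd (fun y => F (u y)) i x = F' * pd u i x := by
  unfold pd
  have := hF.comp_hasFDerivAt x hu.hasFDerivAt
  rw [show (fun y => F (u y)) = F ∘ u from rfl, this.fderiv]
  simp

/-! ### Growth -/

lemma growth_abs (f : ℝ → ℝ) (hf : Continuous f) (C q : ℝ) (hq : 1 < q)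
    (hg : ∀ t : ℝ, 0 ≤ t * f t ∧ t * f t ≤ C * (t ^ 2 + |t| ^ q)) (t : ℝ) :
    |f t| ≤ C * (|t| + |t| ^ (q - 1)) := by
  have hcl : IsClosed {t : ℝ | |f t| ≤ C * (|t| + |t| ^ (q - 1))} := by
    apply isClosed_le hf.abs
    apply continuous_const.mul
    apply continuous_abs.add
    exact continuous_abs.rpow_const (fun x => Or.inr (by linarith))
  have hsub : ({0}ᶜ : Set ℝ) ⊆ {t : ℝ | |f t| ≤ C * (|t| + |t| ^ (q - 1))} := by
    intro s hs
    have hs0 : 0 < |s| := abs_pos.2 hs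
    obtain ⟨h1, h2⟩ := hg s
    have e1 : |s| * |f s| = s * f s := by rw [← abs_mul, abs_of_nonneg h1]
    have e2 : |s| ^ q = |s| * |s| ^ (q - 1) := by
      rw [Real.rpow_sub_one hs0.ne']; field_simp
    rw [← e1, e2, ← sq_abs] at h2
    have : |s| * |f s| ≤ |s| * (C * (|s| + |s| ^ (q - 1))) := by
      refine h2.trans (le_of_eq ?_); ring
    exact le_of_mul_le_mul_left this hs0
  have := hcl.closure_subset_iff.2 hsub
  rw [(dense_compl_singleton (0 : ℝ)).closure_eq] at this
  exact this (Set.mem_univ t)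

lemma growth_prim (f F : ℝ → ℝ) (hf : Continuous f) (C q : ℝ) (hC : 0 < C) (hq : 1 < q)
    (hg : ∀ t : ℝ, 0 ≤ t * f t ∧ t * f t ≤ C * (t ^ 2 + |t| ^ q))
    (hF : ∀ t : ℝ, F t = ∫ s in (0 : ℝ)..t, f s) (t : ℝ) :
    |F t| ≤ C * (t ^ 2 + |t| ^ q) := by
  by_cases ht : t = 0
  · rw [hF, ht]; simp; positivity
  have ht0 : 0 < |t| := abs_pos.2 ht
  have := intervalIntegral.norm_integral_le_of_norm_le_const (a := 0) (b := t) (f := f)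
    (C := C * (|t| + |t| ^ (q - 1))) (by
      intro s hs
      have hst : |s| ≤ |t| := by
        rcases le_total 0 t with h | h
        · rw [Set.uIoc_of_le h] at hs
          rw [abs_of_pos hs.1, abs_of_nonneg h]; exact hs.2
        · rw [Set.uIoc_of_ge h] at hs
          rw [abs_of_nonpos hs.2, abs_of_nonpos h]; linarith [hs.1]
      refine (growth_abs f hf C q hq hg s).trans ?_
      gcongr)
  rw [← hF, sub_zero, Real.norm_eq_abs] at this
  refine this.trans (le_of_eq ?_)
  have e2 : |t| ^ q = |t| * |t| ^ (q - 1) := by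
    rw [Real.rpow_sub_one ht0.ne']; field_simp
  rw [e2, ← sq_abs]; ring

lemma prim_nonneg (f F : ℝ → ℝ) (hg : ∀ t : ℝ, 0 ≤ t * f t)
    (hF : ∀ t : ℝ, F t = ∫ s in (0 : ℝ)..t, f s) (t : ℝ) : 0 ≤ F t := by
  rw [hF]
  rcases le_total 0 t with h | h
  · rw [intervalIntegral.integral_of_le h]
    apply setIntegral_nonneg measurableSet_Ioc
    intro s hs
    exact nonneg_of_mul_nonneg_right (hg s) hs.1
  · rw [intervalIntegral.integral_symm, intervalIntegral.integral_of_le h,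
      ← integral_Ioc_eq_integral_Ioo.symm, neg_nonneg]
    apply setIntegral_nonpos measurableSet_Ioo
    intro s hs
    have := hg s
    by_contra hh
    push Not at hh
    nlinarith [hs.2]

lemma prim_deriv (f F : ℝ → ℝ) (hf : Continuous f)
    (hF : ∀ t : ℝ, F t = ∫ s in (0 : ℝ)..t, f s) (t : ℝ) : HasDerivAt F (f t) t := by
  have : F = fun t => ∫ s in (0 : ℝ)..t, f s := funext hF
  rw [this]
  exact (hf.integral_hasStrictDerivAt 0 t).hasDerivAt

lemma exps (N : ℕ) (hN : 3 ≤ N) : 2 ≤ twoStarL N ∧ twoStarL N ≤ twoStar N ∧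
    2 * (twoStarL N - 1) = twoStar N := by
  have hN' : (3 : ℝ) ≤ N := by exact_mod_cast hN
  have h0 : 0 < (N : ℝ) - 2 := by linarith
  unfold twoStar twoStarL
  refine ⟨?_, ?_, ?_⟩
  · rw [le_div_iff₀ h0]; linarith
  · gcongr; linarith
  · field_simp; ring

lemma rpow_mid (t p q : ℝ) (hp : 2 ≤ p) (hpq : p ≤ q) : |t| ^ p ≤ t ^ 2 + |t| ^ q := by
  rcases le_total |t| 1 with h | h
  · have h1 : |t| ^ p ≤ |t| ^ (2 : ℝ) :=
      Real.rpow_le_rpow_of_exponent_ge' (abs_nonneg t) h (by norm_num) hp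
    rw [Real.rpow_two, sq_abs] at h1
    have : 0 ≤ |t| ^ q := by positivity
    linarith
  · have h1 := Real.rpow_le_rpow_of_exponent_le h hpq
    nlinarith [sq_nonneg t]

/-! ### Data -/

structure Dat (n : ℕ) (h : 0 < n + 1) (f g F G : ℝ → ℝ) (C₁ C₂ : ℝ) (u : Euc (n + 1) → ℝ) :
    Prop where
  hN : 3 ≤ n + 1
  hf : Continuous f
  hg : Continuous g
  hC₁ : 0 < C₁
  hC₂ : 0 < C₂
  growf : ∀ t : ℝ, 0 ≤ t * f t ∧ t * f t ≤ C₁ * (t ^ 2 + |t| ^ twoStar (n + 1))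
  growg : ∀ t : ℝ, 0 ≤ t * g t ∧ t * g t ≤ C₂ * (t ^ 2 + |t| ^ twoStarL (n + 1))
  hF : ∀ t : ℝ, F t = ∫ s in (0 : ℝ)..t, f s
  hG : ∀ t : ℝ, G t = ∫ s in (0 : ℝ)..t, g s
  h2 : ContDiffOn ℝ 2 u (upperHS (n + 1) h)
  h1 : ContDiffOn ℝ 1 u (upperHSc (n + 1) h)
  hX : FiniteEnergy (n + 1) h u

namespace Dat

variable {n : ℕ} {h : 0 < n + 1} {f g F G : ℝ → ℝ} {C₁ C₂ : ℝ} {u : Euc (n + 1) → ℝ}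

lemma gradSq_nonneg {N : ℕ} (u : Euc N → ℝ) (x : Euc N) : 0 ≤ gradSq u x :=
  Finset.sum_nonneg fun _ _ => sq_nonneg _

lemma meas : MeasurableSet (upperHS (n + 1) h) := (isOpen_upperHS (n + 1) h).measurableSet

lemma cd (d : Dat n h f g F G C₁ C₂ u) {x : Euc (n + 1)} (hx : x ∈ upperHS (n + 1) h) :
    ContDiffAt ℝ 2 u x := d.h2.contDiffAt ((isOpen_upperHS (n + 1) h).mem_nhds hx)

lemma du (d : Dat n h f g F G C₁ C₂ u) {x : Euc (n + 1)} (hx : x ∈ upperHS (n + 1) h) :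
    DifferentiableAt ℝ u x := (d.cd hx).differentiableAt (by norm_num)

lemma dfd (d : Dat n h f g F G C₁ C₂ u) {x : Euc (n + 1)} (hx : x ∈ upperHS (n + 1) h) :
    DifferentiableAt ℝ (fderiv ℝ u) x :=
  ((d.cd hx).fderiv_right (m := 1) (by norm_num)).differentiableAt (by norm_num)

lemma dpd (d : Dat n h f g F G C₁ C₂ u) (i : Fin (n + 1)) {x : Euc (n + 1)}
    (hx : x ∈ upperHS (n + 1) h) :
    DifferentiableAt ℝ (pd u i) x :=
  (d.dfd hx).clm_apply (differentiableAt_const _)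

lemma pd_symm (d : Dat n h f g F G C₁ C₂ u) (i j : Fin (n + 1)) {x : Euc (n + 1)}
    (hx : x ∈ upperHS (n + 1) h) : pd (pd u i) j x = pd (pd u j) i x := by
  have hs := (d.cd hx).isSymmSndFDerivAt (by simp)
  have e : ∀ i j, pd (pd u i) j x = fderiv ℝ (fderiv ℝ u) x (EuclideanSpace.single j 1)
      (EuclideanSpace.single i 1) := by
    intro i j
    have := fderiv_clm_apply (d.dfd hx)
      (differentiableAt_const (EuclideanSpace.single i (1 : ℝ) : Euc (n + 1)))
    unfold pd
    rw [this]
    simp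
  rw [e, e]
  exact hs _ _

lemma cont_u (d : Dat n h f g F G C₁ C₂ u) : ContinuousOn u (upperHSc (n + 1) h) :=
  d.h1.continuousOn

lemma cont_fd (d : Dat n h f g F G C₁ C₂ u) : ContinuousOn (fderiv ℝ u) (upperHS (n + 1) h) :=
  fun _ hx => (d.dfd hx).continuousAt.continuousWithinAt

lemma cont_pd (d : Dat n h f g F G C₁ C₂ u) (i) : ContinuousOn (pd u i) (upperHS (n + 1) h) :=
  fun _ hx => (d.dpd i hx).continuousAt.continuousWithinAt

lemma cont_gradSq (d : Dat n h f g F G C₁ C₂ u) : ContinuousOn (gradSq u) (upperHS (n + 1) h) := by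
  unfold gradSq
  exact continuousOn_finsetSum _ fun i _ => (d.cont_pd i).pow 2

lemma cont_radial (d : Dat n h f g F G C₁ C₂ u) : ContinuousOn (radial u) (upperHS (n + 1) h) := by
  unfold radial
  exact continuousOn_finsetSum _ fun i _ =>
    ((EuclideanSpace.proj (𝕜 := ℝ) i).continuous.continuousOn).mul (d.cont_pd i)

lemma Kw_one {N : ℕ} (x : Euc N) : 1 ≤ Kw x := by
  unfold Kw; exact Real.one_le_exp (by positivity)

lemma int_gradSq (d : Dat n h f g F G C₁ C₂ u) : IntegrableOn (gradSq u) (upperHS (n + 1) h) := by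
  refine Integrable.mono' d.hX (d.cont_gradSq.aestronglyMeasurable meas) ?_
  refine Eventually.of_forall fun x => ?_
  rw [Real.norm_of_nonneg (gradSq_nonneg u x)]
  nlinarith [Kw_one x, gradSq_nonneg u x, sq_nonneg (u x)]

lemma int_u2 (d : Dat n h f g F G C₁ C₂ u) :
    IntegrableOn (fun x => (u x) ^ 2) (upperHS (n + 1) h) := by
  refine Integrable.mono' d.hX (((d.cont_u.mono (upperHS_subset _ _)).pow 2).aestronglyMeasurable
    meas) ?_
  refine Eventually.of_forall fun x => ?_
  rw [Real.norm_of_nonneg (sq_nonneg _)]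
  nlinarith [Kw_one x, gradSq_nonneg u x, sq_nonneg (u x)]

lemma radial_sq_le {N : ℕ} (u : Euc N → ℝ) (x : Euc N) :
    (radial u x) ^ 2 ≤ ‖x‖ ^ 2 * gradSq u x := by
  rw [radial_eq]; exact clm_sq_le _ _

lemma int_radial (d : Dat n h f g F G C₁ C₂ u) :
    IntegrableOn (fun x => (radial u x) ^ 2) (upperHS (n + 1) h) := by
  refine Integrable.mono' (d.hX.const_mul 4) ((d.cont_radial.pow 2).aestronglyMeasurable meas) ?_
  refine Eventually.of_forall fun x => ?_
  rw [Real.norm_of_nonneg (sq_nonneg _)]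
  refine (radial_sq_le u x).trans ?_
  have hK : ‖x‖ ^ 2 ≤ 4 * Kw x := by
    unfold Kw
    linarith [Real.add_one_le_exp (‖x‖ ^ 2 / 4)]
  have hg := gradSq_nonneg u x
  have := mul_le_mul_of_nonneg_right hK hg
  have h3 : 0 ≤ Kw x * (u x) ^ 2 := mul_nonneg (by linarith [Kw_one x]) (sq_nonneg _)
  nlinarith

lemma int_us (d : Dat n h f g F G C₁ C₂ u) :
    IntegrableOn (fun x => |u x| ^ twoStar (n + 1)) (upperHS (n + 1) h) := by
  have hcu := (d.cont_u.mono (upperHS_subset _ _)).aestronglyMeasurable (μ := volume)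
    (meas (n := n) (h := h))
  have hm := sobolev_half (n + 1) d.hN h u d.h1
    ((memLp_two_iff_integrable_sq hcu).2 d.int_u2)
    ((memLp_two_iff_integrable_sq_norm (d.cont_fd.aestronglyMeasurable meas)).2 (by
      refine Integrable.mono' d.int_gradSq
        ((d.cont_fd.norm.pow 2).aestronglyMeasurable meas) ?_
      refine Eventually.of_forall fun x => ?_
      rw [Real.norm_of_nonneg (sq_nonneg _)]
      exact clm_norm_sq_le _))
  have e := exps (n + 1) d.hN
  have h0 : 0 < twoStar (n + 1) := by linarith [e.1, e.2.1]
  have := hm.integrable_norm_rpow (by simpa using h0) ENNReal.ofReal_ne_top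
  rw [ENNReal.toReal_ofReal h0.le] at this
  exact this

lemma int_U (d : Dat n h f g F G C₁ C₂ u) :
    IntegrableOn (fun x => (u x) ^ 2 + |u x| ^ twoStar (n + 1)) (upperHS (n + 1) h) :=
  d.int_u2.add d.int_us

lemma dF (d : Dat n h f g F G C₁ C₂ u) (t : ℝ) : HasDerivAt F (f t) t := prim_deriv f F d.hf d.hF t
lemma dG (d : Dat n h f g F G C₁ C₂ u) (t : ℝ) : HasDerivAt G (g t) t := prim_deriv g G d.hg d.hG t
lemma cF (d : Dat n h f g F G C₁ C₂ u) : Continuous F :=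
  continuous_iff_continuousAt.2 fun t => (d.dF t).continuousAt
lemma cG (d : Dat n h f g F G C₁ C₂ u) : Continuous G :=
  continuous_iff_continuousAt.2 fun t => (d.dG t).continuousAt

lemma int_F (d : Dat n h f g F G C₁ C₂ u) :
    IntegrableOn (fun x => F (u x)) (upperHS (n + 1) h) := by
  have e := exps (n + 1) d.hN
  refine Integrable.mono' (d.int_U.const_mul C₁)
    ((d.cF.comp_continuousOn (d.cont_u.mono (upperHS_subset _ _))).aestronglyMeasurable meas) ?_
  refine Eventually.of_forall fun x => ?_
  exact growth_prim f F d.hf C₁ _ d.hC₁ (by linarith [e.1, e.2.1]) d.growf d.hF (u x)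

lemma int_G (d : Dat n h f g F G C₁ C₂ u) :
    IntegrableOn (fun x => G (u x)) (upperHS (n + 1) h) := by
  have e := exps (n + 1) d.hN
  refine Integrable.mono' (d.int_U.const_mul (2 * C₂))
    ((d.cG.comp_continuousOn (d.cont_u.mono (upperHS_subset _ _))).aestronglyMeasurable meas) ?_
  refine Eventually.of_forall fun x => ?_
  refine (growth_prim g G d.hg C₂ _ d.hC₂ (by linarith [e.1]) d.growg d.hG (u x)).trans ?_
  have := rpow_mid (u x) _ _ e.1 e.2.1
  have h3 : 0 ≤ |u x| ^ twoStar (n + 1) := by positivity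
  have hC := d.hC₂
  have h4 : (u x) ^ 2 + |u x| ^ twoStarL (n + 1) ≤ 2 * ((u x) ^ 2 + |u x| ^ twoStar (n + 1)) := by
    linarith [sq_nonneg (u x)]
  calc _ ≤ C₂ * (2 * ((u x) ^ 2 + |u x| ^ twoStar (n + 1))) := by gcongr
    _ = _ := by ring

lemma int_gdu (d : Dat n h f g F G C₁ C₂ u) (i : Fin (n + 1)) :
    IntegrableOn (fun x => g (u x) * pd u i x) (upperHS (n + 1) h) := by
  have e := exps (n + 1) d.hN
  refine Integrable.mono' ((d.int_U.const_mul (C₂ ^ 2)).add d.int_gradSq)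
    (((d.hg.comp_continuousOn (d.cont_u.mono (upperHS_subset _ _))).mul
      (d.cont_pd i)).aestronglyMeasurable meas) ?_
  refine Eventually.of_forall fun x => ?_
  have h1 := growth_abs g d.hg C₂ _ (by linarith [e.1]) d.growg (u x)
  have hp : (pd u i x) ^ 2 ≤ gradSq u x := by
    unfold gradSq
    exact Finset.single_le_sum (f := fun i => (pd u i x) ^ 2) (fun _ _ => sq_nonneg _)
      (Finset.mem_univ i)
  have h2 : (|u x| ^ (twoStarL (n + 1) - 1)) ^ 2 = |u x| ^ twoStar (n + 1) := by
    rw [← Real.rpow_natCast, ← Real.rpow_mul (abs_nonneg _), ← e.2.2]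
    congr 1
    push_cast; ring
  have h3 : (g (u x)) ^ 2 ≤ C₂ ^ 2 * (2 * ((u x) ^ 2 + |u x| ^ twoStar (n + 1))) := by
    have := pow_le_pow_left₀ (abs_nonneg _) h1 2
    rw [sq_abs, mul_pow] at this
    refine this.trans ?_
    gcongr
    rw [← h2, ← sq_abs (u x)]
    nlinarith [sq_nonneg (|u x| - |u x| ^ (twoStarL (n + 1) - 1))]
  rw [Real.norm_eq_abs, abs_mul]
  simp only [Pi.add_apply]
  have h4 : 2 * (|g (u x)| * |pd u i x|) ≤ (g (u x)) ^ 2 + (pd u i x) ^ 2 := by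
    rw [← sq_abs (g (u x)), ← sq_abs (pd u i x)]
    nlinarith [sq_nonneg (|g (u x)| - |pd u i x|)]
  nlinarith [gradSq_nonneg u x]

/-! ### Boundary -/

lemma emb_last (y : Euc n) : emb (n + 1) y (Fin.last n) = 0 := by
  simp [emb]

lemma emb_castSucc (y : Euc n) (j : Fin n) : emb (n + 1) y j.castSucc = y j := by
  simp [emb]

lemma emb_norm (y : Euc n) : ‖emb (n + 1) y‖ = ‖y‖ := by
  have : ‖emb (n + 1) y‖ ^ 2 = ‖y‖ ^ 2 := by
    rw [EuclideanSpace.norm_sq_eq, EuclideanSpace.norm_sq_eq, Fin.sum_univ_castSucc]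
    simp only [emb_last, emb_castSucc]
    simp
  exact (pow_left_inj₀ (norm_nonneg _) (norm_nonneg _) (by norm_num)).1 this

def embL (n : ℕ) : Euc n →L[ℝ] Euc (n + 1) :=
  LinearMap.toContinuousLinearMap
    { toFun := fun y => emb (n + 1) y
      map_add' := by
        intro y z
        ext i
        refine Fin.lastCases ?_ (fun j => ?_) i <;>
          simp only [PiLp.add_apply, emb_last, emb_castSucc, add_zero]
      map_smul' := by
        intro c y
        ext i
        refine Fin.lastCases ?_ (fun j => ?_) i <;>
          simp only [PiLp.smul_apply, emb_last, emb_castSucc, smul_zero, RingHom.id_apply] }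

lemma embL_apply (y : Euc n) : embL n y = emb (n + 1) y := rfl

lemma emb_mem (h : 0 < n + 1) (y : Euc n) : emb (n + 1) y ∈ upperHSc (n + 1) h := by
  have : emb (n + 1) y (lastIdx (n + 1) h) = 0 := emb_last y
  simp only [upperHSc, Set.mem_ofPred_eq, this, le_refl]

lemma phi_emb (k : ℕ) (y : Euc n) : phi k (emb (n + 1) y) = phi k y := by
  unfold phi; rw [emb_norm]

lemma embL_single (j : Fin n) : embL n (EuclideanSpace.single j 1) =
    EuclideanSpace.single j.castSucc 1 := by
  ext i
  rw [embL_apply]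
  refine Fin.lastCases ?_ (fun l => ?_) i
  · rw [emb_last]; simp
  · rw [emb_castSucc]; simp [Pi.single_apply]

/-- trace of u -/
lemma tr_hasFDerivAt (d : Dat n h f g F G C₁ C₂ u) (y : Euc n) :
    HasFDerivAt (fun y => u (emb (n + 1) y))
      ((fderivWithin ℝ u (upperHSc (n + 1) h) (emb (n + 1) y)).comp (embL n)) y := by
  have h1 := (d.h1.differentiableOn (by norm_num) _ (emb_mem h y)).hasFDerivWithinAt
  have h2 := h1.comp_hasFDerivAt_of_eq (f := embL n) y (embL n).hasFDerivAt
    (Eventually.of_forall fun y => emb_mem h y) rfl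
  exact h2

lemma tr_contDiff (d : Dat n h f g F G C₁ C₂ u) : ContDiff ℝ 1 (fun y => u (emb (n + 1) y)) :=
  d.h1.comp_contDiff (embL n).contDiff (fun y => emb_mem h y)

end Dat


lemma pd_abs_le {N : ℕ} (a : Euc N → ℝ) (i : Fin N) (x : Euc N) : |pd a i x| ≤ ‖fderiv ℝ a x‖ := by
  have := (fderiv ℝ a x).le_opNorm (EuclideanSpace.single i 1)
  simpa [pd] using this

lemma pd_phi_bound : ∃ C : ℝ, 0 ≤ C ∧ ∀ (N k : ℕ) (i : Fin N) (x : Euc N),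
    |pd (phi k) i x| ≤ C ∧ |pd (phi k) i x| * ‖x‖ ≤ C := by
  obtain ⟨C, hC, hb⟩ := phi_fderiv_bound
  refine ⟨C, hC, fun N k i x => ?_⟩
  have h1 := pd_abs_le (phi k) i x
  have h2 := hb N k x
  have h3 := norm_nonneg (fderiv ℝ (phi k) x)
  have h4 := norm_nonneg x
  have h5 := mul_nonneg h3 h4
  constructor
  · nlinarith
  · have := mul_le_mul_of_nonneg_right h1 h4
    nlinarith

lemma pd_phi_cont {N : ℕ} (k : ℕ) (i : Fin N) : Continuous (pd (phi k) i) := by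
  have := (phi_contDiff (n := N) k).continuous_fderiv (by norm_num)
  exact this.clm_apply continuous_const

lemma phi_diff {N : ℕ} (k : ℕ) (x : Euc N) : DifferentiableAt ℝ (phi k) x :=
  (phi_contDiff k).differentiable (by norm_num) x

lemma pd_phi_zero {N : ℕ} (k : ℕ) (i : Fin N) (x : Euc N) (hx : ‖x‖ ≤ (k : ℝ) + 1) :
    pd (phi k) i x = 0 := by
  unfold pd; rw [phi_fderiv_zero k x hx]; simp

namespace Dat

variable {n : ℕ} {h : 0 < n + 1} {f g F G : ℝ → ℝ} {C₁ C₂ : ℝ} {u : Euc (n + 1) → ℝ}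

lemma G_nonneg (d : Dat n h f g F G C₁ C₂ u) (t : ℝ) : 0 ≤ G t :=
  prim_nonneg g G (fun t => (d.growg t).1) d.hG t

lemma contGb (d : Dat n h f g F G C₁ C₂ u) : Continuous (fun y : Euc n => G (u (emb (n + 1) y))) :=
  d.cG.comp d.tr_contDiff.continuous

lemma DG_int (d : Dat n h f g F G C₁ C₂ u) {C : ℝ}
    (hC : ∀ (N k : ℕ) (i : Fin N) (x : Euc N),
      |pd (phi k) i x| ≤ C ∧ |pd (phi k) i x| * ‖x‖ ≤ C) (k : ℕ) :
    IntegrableOn (fun x => pd (phi k) (Fin.last n) x * G (u x)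
        + phi k x * (g (u x) * pd u (Fin.last n) x)) (upperHS (n + 1) h) ∧
    ∀ x, ‖pd (phi k) (Fin.last n) x * G (u x) + phi k x * (g (u x) * pd u (Fin.last n) x)‖
      ≤ C * ‖G (u x)‖ + ‖g (u x) * pd u (Fin.last n) x‖ := by
  have hb : ∀ x, ‖pd (phi k) (Fin.last n) x * G (u x)
      + phi k x * (g (u x) * pd u (Fin.last n) x)‖
      ≤ C * ‖G (u x)‖ + ‖g (u x) * pd u (Fin.last n) x‖ := by
    intro x
    refine (norm_add_le _ _).trans ?_
    rw [norm_mul, norm_mul (phi k x)]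
    have h1 : ‖pd (phi k) (Fin.last n) x‖ ≤ C := (hC _ k (Fin.last n) x).1
    have h2 : ‖phi k x‖ ≤ 1 := phi_abs k x
    have h3 := mul_le_mul_of_nonneg_right h1 (norm_nonneg (G (u x)))
    have h4 := mul_le_mul_of_nonneg_right h2 (norm_nonneg (g (u x) * pd u (Fin.last n) x))
    linarith
  refine ⟨?_, hb⟩
  have hcu := d.cont_u.mono (upperHS_subset _ _)
  refine Integrable.mono' ((d.int_G.norm.const_mul C).add (d.int_gdu (Fin.last n)).norm) ?_
    (Eventually.of_forall hb)
  refine ContinuousOn.aestronglyMeasurable ?_ meas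
  exact ((pd_phi_cont k _).continuousOn.mul (d.cG.comp_continuousOn hcu)).add
    ((phi_contDiff k).continuous.continuousOn.mul
      ((d.hg.comp_continuousOn hcu).mul (d.cont_pd _)))

lemma Gb_ident (d : Dat n h f g F G C₁ C₂ u) {C : ℝ}
    (hC : ∀ (N k : ℕ) (i : Fin N) (x : Euc N),
      |pd (phi k) i x| ≤ C ∧ |pd (phi k) i x| * ‖x‖ ≤ C) (k : ℕ) :
    ∫ x in upperHS (n + 1) h, (pd (phi k) (Fin.last n) x * G (u x)
        + phi k x * (g (u x) * pd u (Fin.last n) x)) =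
      - ∫ y : Euc n, phi k y * G (u (emb (n + 1) y)) := by
  have hk : (0 : ℝ) < 2 * ((k : ℝ) + 1) := by positivity
  have hdG : ∀ x ∈ upperHS (n + 1) h, DifferentiableAt ℝ (fun y => G (u y)) x := fun x hx =>
    (d.dG (u x)).differentiableAt.comp x (d.du hx)
  have := div_half n h
    (fun i x => if i = Fin.last n then phi k x * G (u x) else 0)
    (fun i x => if i = Fin.last n then phi k x * G (u x) else 0) (2 * ((k : ℝ) + 1)) hk
    (by
      intro i
      by_cases hi : i = Fin.last n
      · simp only [hi, if_true]
        exact (phi_contDiff k).continuous.continuousOn.mul (d.cG.comp_continuousOn d.cont_u)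
      · simp only [hi, if_false]; exact continuousOn_const)
    (fun i x _ => rfl)
    (by
      intro i x hx
      by_cases hi : i = Fin.last n
      · simp only [hi, if_true]
        exact (phi_diff k x).mul (hdG x hx)
      · simp only [hi, if_false]; exact differentiableAt_const _)
    (by
      intro i x hx
      simp only [phi_eq_zero k x hx, zero_mul, ite_self])
    _
    (by
      intro x hx
      rw [Finset.sum_eq_single (Fin.last n)]
      · simp only [if_true]
        rw [pd_mul _ (phi_diff k x) (hdG x hx), pd_comp _ (d.dG (u x)) (d.du hx)]
      · intro b _ hb
        simp only [hb, if_false]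
        simp [pd]
      · simp)
    (d.DG_int hC k).1
  rw [this]
  simp only [if_true, phi_emb]

lemma int_Gb (d : Dat n h f g F G C₁ C₂ u) :
    Integrable (fun y : Euc n => G (u (emb (n + 1) y))) := by
  obtain ⟨C, hC0, hC⟩ := pd_phi_bound
  have hcov : AECover (volume : Measure (Euc n)) atTop
      (fun k : ℕ => Metric.closedBall (0 : Euc n) ((k : ℝ) + 1)) :=
    aecover_closedBall (tendsto_atTop_add_const_right _ _ tendsto_natCast_atTop_atTop)
  have hIntg : ∀ k : ℕ, IntegrableOn (fun y : Euc n => G (u (emb (n + 1) y)))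
      (Metric.closedBall (0 : Euc n) ((k : ℝ) + 1)) := fun k =>
    d.contGb.continuousOn.integrableOn_compact (isCompact_closedBall _ _)
  refine hcov.integrable_of_integral_bounded_of_nonneg_ae
    (∫ x in upperHS (n + 1) h, (C * ‖G (u x)‖ + ‖g (u x) * pd u (Fin.last n) x‖)) hIntg
    (Eventually.of_forall fun y => d.G_nonneg _) (Eventually.of_forall fun k => ?_)
  have hphi : Integrable (fun y : Euc n => phi k y * G (u (emb (n + 1) y))) :=
    ((phi_contDiff k).continuous.mul d.contGb).integrable_of_hasCompactSupport
      ((phi_hcs k).mul_right)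
  have h1 : ∫ y in Metric.closedBall (0 : Euc n) ((k : ℝ) + 1), G (u (emb (n + 1) y))
      ≤ ∫ y : Euc n, phi k y * G (u (emb (n + 1) y)) := by
    calc _ = ∫ y in Metric.closedBall (0 : Euc n) ((k : ℝ) + 1),
            phi k y * G (u (emb (n + 1) y)) := by
          refine setIntegral_congr_fun Metric.isClosed_closedBall.measurableSet fun y hy => ?_
          have : phi k y = 1 := phi_eq_one k y (by simpa using hy)
          simp only [this, one_mul]
      _ ≤ _ := setIntegral_le_integral hphi
          (Eventually.of_forall fun y => mul_nonneg (phi_nonneg k y) (d.G_nonneg _))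
  refine h1.trans ?_
  have h2 := d.Gb_ident hC k
  have h3 := norm_integral_le_of_norm_le
    (((d.int_G.norm.const_mul C).add (d.int_gdu (Fin.last n)).norm))
    (Eventually.of_forall (d.DG_int hC k).2)
  rw [h2, norm_neg] at h3
  exact (le_abs_self _).trans h3

end Dat


/-- the Pohozaev vector field -/
def Wv {N : ℕ} (F : ℝ → ℝ) (u : Euc N → ℝ) (i : Fin N) (x : Euc N) : ℝ :=
  pd u i x * radial u x - x i * ((1 / 2) * gradSq u x) + x i * F (u x)

/-- its continuous version on the closed half space -/
def Wc {N : ℕ} (S : Set (Euc N)) (F : ℝ → ℝ) (u : Euc N → ℝ) (i : Fin N) (x : Euc N) : ℝ :=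
  fderivWithin ℝ u S x (EuclideanSpace.single i 1) *
      (∑ j, x j * fderivWithin ℝ u S x (EuclideanSpace.single j 1))
    - x i * ((1 / 2) * ∑ j, (fderivWithin ℝ u S x (EuclideanSpace.single j 1)) ^ 2)
    + x i * F (u x)

/-- density -/
def Qd {N : ℕ} (F : ℝ → ℝ) (u : Euc N → ℝ) (x : Euc N) : ℝ :=
  -(1 / 2) * (radial u x) ^ 2 + (N : ℝ) * F (u x) - (((N : ℝ) - 2) / 2) * gradSq u x

lemma alg_div {N : ℕ} (x p : Fin N → ℝ) (a : Fin N → Fin N → ℝ) (ha : ∀ i j, a i j = a j i)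
    (r q Fx fx : ℝ) (hr : r = ∑ i, x i * p i) (hq : q = ∑ i, p i ^ 2)
    (hl : -(∑ i, a i i) - (1 / 2) * r = fx) :
    ∑ i, ((a i i * r + p i * (p i + ∑ j, x j * a j i))
      - (1 * ((1 / 2) * q) + x i * ((1 / 2) * ∑ j, 2 * p j * a j i)) + (1 * Fx + x i * (fx * p i)))
    = -(1 / 2) * r ^ 2 + (N : ℝ) * Fx - (((N : ℝ) - 2) / 2) * q := by
  have e1 : ∑ i, a i i * r = (∑ i, a i i) * r := by rw [Finset.sum_mul]
  have e2 : ∑ i, p i * p i = q := by rw [hq]; exact Finset.sum_congr rfl fun i _ => by ring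
  have e3 : ∑ i, p i * ∑ j, x j * a j i = ∑ i, x i * ((1 / 2) * ∑ j, 2 * p j * a j i) := by
    simp only [Finset.mul_sum]
    rw [Finset.sum_comm]
    refine Finset.sum_congr rfl fun i _ => Finset.sum_congr rfl fun j _ => ?_
    rw [ha i j]; ring
  have e4 : ∑ i, x i * (fx * p i) = fx * r := by
    rw [hr, Finset.mul_sum]; exact Finset.sum_congr rfl fun i _ => by ring
  simp only [mul_add, Finset.sum_add_distrib, Finset.sum_sub_distrib, Finset.sum_const,
    Finset.card_univ, Fintype.card_fin, nsmul_eq_mul, one_mul]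
  rw [e1, e2, e3, e4]
  have : ∑ i, a i i = - fx - (1 / 2) * r := by linarith
  rw [this]; ring

namespace Dat

variable {n : ℕ} {h : 0 < n + 1} {f g F G : ℝ → ℝ} {C₁ C₂ : ℝ} {u : Euc (n + 1) → ℝ}

lemma d_radial (d : Dat n h f g F G C₁ C₂ u) {x : Euc (n + 1)} (hx : x ∈ upperHS (n + 1) h) :
    DifferentiableAt ℝ (radial u) x := by
  unfold radial
  exact DifferentiableAt.fun_sum fun j _ => (coord_diff j x).mul (d.dpd j hx)

lemma pd_radial (d : Dat n h f g F G C₁ C₂ u) {x : Euc (n + 1)} (hx : x ∈ upperHS (n + 1) h)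
    (i : Fin (n + 1)) :
    pd (radial u) i x = pd u i x + ∑ j, x j * pd (pd u j) i x := by
  have : pd (radial u) i x = ∑ j, pd (fun y : Euc (n + 1) => y j * pd u j y) i x :=
    pd_sum i fun j => (coord_diff j x).mul (d.dpd j hx)
  rw [this]
  have : ∀ j, pd (fun y : Euc (n + 1) => y j * pd u j y) i x
      = (if j = i then 1 else 0) * pd u j x + x j * pd (pd u j) i x := fun j => by
    rw [pd_mul i (coord_diff j x) (d.dpd j hx), pd_coord]
  simp only [this, Finset.sum_add_distrib]
  congr 1
  simp

lemma d_gradSq (d : Dat n h f g F G C₁ C₂ u) {x : Euc (n + 1)} (hx : x ∈ upperHS (n + 1) h) :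
    DifferentiableAt ℝ (gradSq u) x := by
  unfold gradSq
  exact DifferentiableAt.fun_sum fun j _ => (d.dpd j hx).pow 2

lemma pd_gradSq (d : Dat n h f g F G C₁ C₂ u) {x : Euc (n + 1)} (hx : x ∈ upperHS (n + 1) h)
    (i : Fin (n + 1)) :
    pd (gradSq u) i x = ∑ j, 2 * pd u j x * pd (pd u j) i x := by
  have e : gradSq u = fun y => ∑ j, pd u j y * pd u j y := by
    funext y; unfold gradSq; exact Finset.sum_congr rfl fun j _ => by ring
  rw [e, pd_sum (a := fun j y => pd u j y * pd u j y) i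
    fun j => (d.dpd j hx).mul (d.dpd j hx)]
  refine Finset.sum_congr rfl fun j _ => ?_
  rw [pd_mul i (d.dpd j hx) (d.dpd j hx)]; ring

lemma d_F (d : Dat n h f g F G C₁ C₂ u) {x : Euc (n + 1)} (hx : x ∈ upperHS (n + 1) h) :
    DifferentiableAt ℝ (fun y => F (u y)) x :=
  (d.dF (u x)).differentiableAt.comp x (d.du hx)

lemma d_W (d : Dat n h f g F G C₁ C₂ u) {x : Euc (n + 1)} (hx : x ∈ upperHS (n + 1) h)
    (i : Fin (n + 1)) : DifferentiableAt ℝ (Wv F u i) x := by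
  unfold Wv
  exact (((d.dpd i hx).mul (d.d_radial hx)).sub
    ((coord_diff i x).mul ((d.d_gradSq hx).const_mul _))).add ((coord_diff i x).mul (d.d_F hx))

lemma pd_W (d : Dat n h f g F G C₁ C₂ u) {x : Euc (n + 1)} (hx : x ∈ upperHS (n + 1) h)
    (i : Fin (n + 1)) : pd (Wv F u i) i x =
      (pd (pd u i) i x * radial u x + pd u i x * (pd u i x + ∑ j, x j * pd (pd u j) i x))
      - (1 * ((1 / 2) * gradSq u x) + x i * ((1 / 2) * ∑ j, 2 * pd u j x * pd (pd u j) i x))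
      + (1 * F (u x) + x i * (f (u x) * pd u i x)) := by
  have hA : DifferentiableAt ℝ (fun y => pd u i y * radial u y) x := (d.dpd i hx).mul (d.d_radial hx)
  have hq : DifferentiableAt ℝ (fun y => (1 / 2) * gradSq u y) x := (d.d_gradSq hx).const_mul _
  have hB : DifferentiableAt ℝ (fun y : Euc (n + 1) => y i * ((1 / 2) * gradSq u y)) x :=
    (coord_diff i x).mul hq
  have hE : DifferentiableAt ℝ (fun y : Euc (n + 1) => y i * F (u y)) x :=
    (coord_diff i x).mul (d.d_F hx)
  have hq' : pd (fun y => (1 / 2) * gradSq u y) i x = (1 / 2) * pd (gradSq u) i x := by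
    rw [pd_mul i (differentiableAt_const _) (d.d_gradSq hx)]
    simp [pd]
  have e : Wv F u i = fun x => (pd u i x * radial u x - x i * ((1 / 2) * gradSq u x))
    + x i * F (u x) := rfl
  rw [e, pd_add i (hA.fun_sub hB) hE, pd_sub i hA hB, pd_mul i (d.dpd i hx) (d.d_radial hx),
    pd_mul i (coord_diff i x) hq, pd_mul i (coord_diff i x) (d.d_F hx), pd_coord, hq',
    d.pd_radial hx, d.pd_gradSq hx, pd_comp i (d.dF (u x)) (d.du hx)]
  simp

lemma div_W (d : Dat n h f g F G C₁ C₂ u)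
    (hpde : ∀ x ∈ upperHS (n + 1) h, -lap u x - (1 / 2) * radial u x = f (u x))
    {x : Euc (n + 1)} (hx : x ∈ upperHS (n + 1) h) :
    ∑ i, pd (Wv F u i) i x = Qd F u x := by
  simp only [d.pd_W hx]
  exact alg_div (fun i => x i) (fun i => pd u i x) (fun i j => pd (pd u i) j x)
    (fun i j => d.pd_symm i j hx) (radial u x) (gradSq u x) (F (u x)) (f (u x)) rfl rfl (hpde x hx)

/-- full divergence of cutoff field -/
def Dk (F : ℝ → ℝ) (u : Euc (n + 1) → ℝ) (k : ℕ) (x : Euc (n + 1)) : ℝ :=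
  (∑ i, pd (phi k) i x * Wv F u i x) + phi k x * Qd F u x

lemma div_phiW (d : Dat n h f g F G C₁ C₂ u)
    (hpde : ∀ x ∈ upperHS (n + 1) h, -lap u x - (1 / 2) * radial u x = f (u x))
    {x : Euc (n + 1)} (hx : x ∈ upperHS (n + 1) h) (k : ℕ) :
    ∑ i, pd (fun y => phi k y * Wv F u i y) i x = Dk F u k x := by
  unfold Dk
  rw [← d.div_W hpde hx, Finset.mul_sum, ← Finset.sum_add_distrib]
  exact Finset.sum_congr rfl fun i _ => pd_mul i (phi_diff k x) (d.d_W hx i)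

lemma int_Q (d : Dat n h f g F G C₁ C₂ u) : IntegrableOn (Qd F u) (upperHS (n + 1) h) :=
  ((d.int_radial.const_mul _).add (d.int_F.const_mul _)).sub (d.int_gradSq.const_mul _)

lemma W_bound (F : ℝ → ℝ) (u : Euc (n + 1) → ℝ) (i : Fin (n + 1)) (x : Euc (n + 1)) :
    |Wv F u i x| ≤ ‖x‖ * (2 * gradSq u x + |F (u x)|) := by
  have hp : (pd u i x) ^ 2 ≤ gradSq u x := by
    unfold gradSq
    exact Finset.single_le_sum (f := fun i => (pd u i x) ^ 2) (fun _ _ => sq_nonneg _)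
      (Finset.mem_univ i)
  have hr := radial_sq_le u x
  have hq := gradSq_nonneg u x
  have hx := norm_nonneg x
  have hi := abs_coord_le x i
  have h1 : |pd u i x * radial u x| ≤ ‖x‖ * gradSq u x := by
    apply abs_le_of_sq_le_sq _ (by positivity)
    have := mul_le_mul hp hr (sq_nonneg _) hq
    nlinarith
  have h2 : |x i * ((1 / 2) * gradSq u x)| ≤ ‖x‖ * gradSq u x := by
    rw [abs_mul, abs_of_nonneg (by positivity : 0 ≤ (1 / 2) * gradSq u x)]
    have := mul_le_mul_of_nonneg_right hi hq
    nlinarith [mul_nonneg hx hq]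
  have h3 : |x i * F (u x)| ≤ ‖x‖ * |F (u x)| := by
    rw [abs_mul]; exact mul_le_mul_of_nonneg_right hi (abs_nonneg _)
  unfold Wv
  refine (abs_add_le _ _).trans ?_
  have := abs_sub (pd u i x * radial u x) (x i * ((1 / 2) * gradSq u x))
  linarith

lemma Dk_bound {C : ℝ}
    (hC : ∀ (N k : ℕ) (i : Fin N) (x : Euc N),
      |pd (phi k) i x| ≤ C ∧ |pd (phi k) i x| * ‖x‖ ≤ C) (F : ℝ → ℝ) (u : Euc (n + 1) → ℝ)
    (k : ℕ) (x : Euc (n + 1)) :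
    ‖Dk F u k x‖ ≤ ((n : ℝ) + 1) * C * (2 * gradSq u x + |F (u x)|) + ‖Qd F u x‖ := by
  unfold Dk
  refine (norm_add_le _ _).trans ?_
  have hq := gradSq_nonneg u x
  gcongr
  · refine (norm_sum_le _ _).trans ?_
    have : ∀ i ∈ (Finset.univ : Finset (Fin (n + 1))), ‖pd (phi k) i x * Wv F u i x‖
        ≤ C * (2 * gradSq u x + |F (u x)|) := by
      intro i _
      rw [norm_mul, Real.norm_eq_abs, Real.norm_eq_abs]
      calc _ ≤ |pd (phi k) i x| * (‖x‖ * (2 * gradSq u x + |F (u x)|)) := by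
            gcongr; exact W_bound F u i x
        _ = (|pd (phi k) i x| * ‖x‖) * (2 * gradSq u x + |F (u x)|) := by ring
        _ ≤ _ := by gcongr; exact (hC _ k i x).2
    refine (Finset.sum_le_sum this).trans (le_of_eq ?_)
    simp; ring
  · rw [norm_mul]
    exact mul_le_of_le_one_left (norm_nonneg _) (phi_abs k x)

lemma int_dom (d : Dat n h f g F G C₁ C₂ u) (C : ℝ) :
    IntegrableOn (fun x => ((n : ℝ) + 1) * C * (2 * gradSq u x + |F (u x)|) + ‖Qd F u x‖)
      (upperHS (n + 1) h) :=
  (((d.int_gradSq.const_mul 2).add d.int_F.norm).const_mul _).add d.int_Q.norm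

lemma Dk_meas (d : Dat n h f g F G C₁ C₂ u) (k : ℕ) :
    AEStronglyMeasurable (Dk F u k) (volume.restrict (upperHS (n + 1) h)) := by
  refine ContinuousOn.aestronglyMeasurable ?_ meas
  have hF := d.cF.comp_continuousOn (d.cont_u.mono (upperHS_subset _ _))
  have hQ : ContinuousOn (Qd F u) (upperHS (n + 1) h) :=
    ((continuousOn_const.mul (d.cont_radial.pow 2)).add (continuousOn_const.mul hF)).sub
      (continuousOn_const.mul d.cont_gradSq)
  unfold Dk
  refine ContinuousOn.add (continuousOn_finsetSum _ fun i _ =>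
    (pd_phi_cont k i).continuousOn.mul ?_) ((phi_contDiff k).continuous.continuousOn.mul hQ)
  exact fun x hx => (d.d_W hx i).continuousAt.continuousWithinAt

lemma pd_eq (d : Dat n h f g F G C₁ C₂ u) {x : Euc (n + 1)} (hx : x ∈ upperHS (n + 1) h)
    (i : Fin (n + 1)) :
    fderivWithin ℝ u (upperHSc (n + 1) h) x (EuclideanSpace.single i 1) = pd u i x := by
  rw [fderivWithin_of_mem_nhds (upperHSc_mem_nhds hx)]; rfl

lemma ident_k (d : Dat n h f g F G C₁ C₂ u)
    (hpde : ∀ x ∈ upperHS (n + 1) h, -lap u x - (1 / 2) * radial u x = f (u x)) {C : ℝ}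
    (hC : ∀ (N k : ℕ) (i : Fin N) (x : Euc N),
      |pd (phi k) i x| ≤ C ∧ |pd (phi k) i x| * ‖x‖ ≤ C) (k : ℕ) :
    ∫ x in upperHS (n + 1) h, Dk F u k x =
      - ∫ y : Euc n, phi k y * Wc (upperHSc (n + 1) h) F u (Fin.last n) (emb (n + 1) y) := by
  have hk : (0 : ℝ) < 2 * ((k : ℝ) + 1) := by positivity
  have hg := gradW_cont (n + 1) h u d.h1
  have hgi : ∀ i : Fin (n + 1), ContinuousOn
      (fun x => fderivWithin ℝ u (upperHSc (n + 1) h) x (EuclideanSpace.single i 1))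
      (upperHSc (n + 1) h) := fun i => hg.clm_apply continuousOn_const
  have hco : ∀ i : Fin (n + 1), ContinuousOn (fun x : Euc (n + 1) => x i)
      (upperHSc (n + 1) h) := fun i => (EuclideanSpace.proj (𝕜 := ℝ) i).continuous.continuousOn
  rw [div_half n h (fun i x => phi k x * Wv F u i x)
    (fun i x => phi k x * Wc (upperHSc (n + 1) h) F u i x) (2 * ((k : ℝ) + 1)) hk
    (by
      intro i
      refine (phi_contDiff k).continuous.continuousOn.mul ?_
      unfold Wc
      exact (((hgi i).mul (continuousOn_finsetSum _ fun j _ => (hco j).mul (hgi j))).sub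
        ((hco i).mul (continuousOn_const.mul (continuousOn_finsetSum _ fun j _ =>
          (hgi j).pow 2)))).add ((hco i).mul (d.cF.comp_continuousOn d.cont_u)))
    (by
      intro i x hx
      simp only [Wv, Wc, d.pd_eq hx, radial, gradSq])
    (fun i x hx => (phi_diff k x).mul (d.d_W hx i))
    (fun i x hx => by simp only [phi_eq_zero k x hx, zero_mul])
    (Dk F u k) (fun x hx => d.div_phiW hpde hx k)
    (Integrable.mono' (d.int_dom C) (d.Dk_meas k) (Eventually.of_forall (Dk_bound hC F u k)))]
  simp only [phi_emb]

/-! ### boundary integration by parts -/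

lemma tr_pd (d : Dat n h f g F G C₁ C₂ u) (j : Fin n) (y : Euc n) :
    pd (fun y => G (u (emb (n + 1) y))) j y = g (u (emb (n + 1) y)) *
      fderivWithin ℝ u (upperHSc (n + 1) h) (emb (n + 1) y)
        (EuclideanSpace.single j.castSucc 1) := by
  have h1 := d.tr_hasFDerivAt y
  have h2 := pd_comp (u := fun y => u (emb (n + 1) y)) j (d.dG (u (emb (n + 1) y)))
    h1.differentiableAt
  refine h2.trans ?_
  congr 1
  unfold pd
  rw [h1.fderiv, ContinuousLinearMap.comp_apply, embL_single]

lemma Wc_bdry (d : Dat n h f g F G C₁ C₂ u)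
    (hbc : ∀ x ∈ bdryHS (n + 1) h, -pdN (n + 1) h u x = g (u x)) (y : Euc n) :
    Wc (upperHSc (n + 1) h) F u (Fin.last n) (emb (n + 1) y)
      = - ∑ j : Fin n, y j * pd (fun y => G (u (emb (n + 1) y))) j y := by
  have hb := hbc (emb (n + 1) y) (emb_last y)
  have hb' : fderivWithin ℝ u (upperHSc (n + 1) h) (emb (n + 1) y)
      (EuclideanSpace.single (Fin.last n) 1) = - g (u (emb (n + 1) y)) := by
    have : pdN (n + 1) h u (emb (n + 1) y) = - g (u (emb (n + 1) y)) := by linarith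
    exact this
  unfold Wc
  rw [Fin.sum_univ_castSucc]
  simp only [d.tr_pd, emb_last, emb_castSucc, zero_mul, add_zero, sub_zero, hb']
  rw [neg_mul, Finset.mul_sum]
  congr 1
  exact Finset.sum_congr rfl fun j _ => by ring

/-- the boundary density -/
def Bk (u : Euc (n + 1) → ℝ) (G : ℝ → ℝ) (k : ℕ) (y : Euc n) : ℝ :=
  ((∑ j, pd (phi k) j y * y j) + (n : ℝ) * phi k y) * G (u (emb (n + 1) y))

lemma bdry_ibp (d : Dat n h f g F G C₁ C₂ u) (k : ℕ) :
    ∫ y : Euc n, ∑ j : Fin n, (phi k y * y j) * pd (fun y => G (u (emb (n + 1) y))) j y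
      = - ∫ y : Euc n, Bk u G k y := by
  have hGd : Differentiable ℝ (fun y : Euc n => G (u (emb (n + 1) y))) := fun y =>
    (d.dG _).differentiableAt.comp y (d.tr_hasFDerivAt y).differentiableAt
  have hcpd : ∀ j, Continuous (pd (fun y : Euc n => G (u (emb (n + 1) y))) j) := by
    intro j
    have : pd (fun y : Euc n => G (u (emb (n + 1) y))) j = fun y => g (u (emb (n + 1) y)) *
        pd (fun y => u (emb (n + 1) y)) j y := by
      funext y
      exact pd_comp (u := fun y => u (emb (n + 1) y)) j (d.dG (u (emb (n + 1) y)))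
        (d.tr_hasFDerivAt y).differentiableAt
    rw [this]
    exact (d.hg.comp d.tr_contDiff.continuous).mul
      ((d.tr_contDiff.continuous_fderiv (by norm_num)).clm_apply continuous_const)
  have hcc : ∀ j : Fin n, Continuous (fun y : Euc n => y j) := fun j =>
    (EuclideanSpace.proj (𝕜 := ℝ) j).continuous
  have hφ := (phi_contDiff (n := n) k).continuous
  have hs : ∀ j : Fin n, HasCompactSupport (fun y : Euc n => phi k y * y j) := fun j =>
    (phi_hcs k).mul_right
  have hpa : ∀ (j : Fin n) (y : Euc n), pd (fun y : Euc n => phi k y * y j) j y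
      = pd (phi k) j y * y j + phi k y := fun j y => by
    rw [pd_mul j (phi_diff k y) (coord_diff j y), pd_coord]; simp
  have hcpa : ∀ j : Fin n, Continuous (fun y => pd (fun y : Euc n => phi k y * y j) j y) := by
    intro j
    simp only [hpa]
    exact ((pd_phi_cont k j).mul (hcc j)).add hφ
  have hI1 : ∀ j : Fin n, Integrable (fun y : Euc n => (phi k y * y j) *
      pd (fun y => G (u (emb (n + 1) y))) j y) := fun j =>
    ((hφ.mul (hcc j)).mul (hcpd j)).integrable_of_hasCompactSupport (hs j).mul_right
  have hI2 : ∀ j : Fin n, Integrable (fun y : Euc n => pd (fun y : Euc n => phi k y * y j) j y *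
      G (u (emb (n + 1) y))) := fun j =>
    ((hcpa j).mul d.contGb).integrable_of_hasCompactSupport
      (((hs j).fderiv_apply (𝕜 := ℝ) (EuclideanSpace.single j 1)).mul_right)
  have hI3 : ∀ j : Fin n, Integrable (fun y : Euc n => (phi k y * y j) *
      G (u (emb (n + 1) y))) := fun j =>
    ((hφ.mul (hcc j)).mul d.contGb).integrable_of_hasCompactSupport (hs j).mul_right
  rw [integral_finsetSum _ fun j _ => hI1 j]
  have key : ∀ j : Fin n, ∫ y : Euc n, (phi k y * y j) * pd (fun y => G (u (emb (n + 1) y))) j y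
      = - ∫ y : Euc n, pd (fun y : Euc n => phi k y * y j) j y * G (u (emb (n + 1) y)) := fun j =>
    integral_mul_fderiv_eq_neg_fderiv_mul_of_integrable (hI2 j) (hI1 j) (hI3 j)
      (fun y _ => (phi_diff k y).mul (coord_diff j y)) (fun y _ => hGd y)
  simp only [key]
  rw [Finset.sum_neg_distrib, ← integral_finsetSum _ fun j _ => hI2 j]
  congr 1
  refine integral_congr_ae (Eventually.of_forall fun y => ?_)
  simp only [hpa, Bk]
  rw [← Finset.sum_mul, Finset.sum_add_distrib]
  simp

lemma ident_k2 (d : Dat n h f g F G C₁ C₂ u)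
    (hpde : ∀ x ∈ upperHS (n + 1) h, -lap u x - (1 / 2) * radial u x = f (u x))
    (hbc : ∀ x ∈ bdryHS (n + 1) h, -pdN (n + 1) h u x = g (u x)) {C : ℝ}
    (hC : ∀ (N k : ℕ) (i : Fin N) (x : Euc N),
      |pd (phi k) i x| ≤ C ∧ |pd (phi k) i x| * ‖x‖ ≤ C) (k : ℕ) :
    ∫ x in upperHS (n + 1) h, Dk F u k x = - ∫ y : Euc n, Bk u G k y := by
  rw [d.ident_k hpde hC k, ← d.bdry_ibp k, ← integral_neg]
  refine integral_congr_ae (Eventually.of_forall fun y => ?_)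
  simp only [d.Wc_bdry hbc]
  rw [mul_neg, neg_neg, Finset.mul_sum]
  exact Finset.sum_congr rfl fun j _ => by ring

/-! ### limit -/

lemma lim_D (d : Dat n h f g F G C₁ C₂ u) {C : ℝ}
    (hC : ∀ (N k : ℕ) (i : Fin N) (x : Euc N),
      |pd (phi k) i x| ≤ C ∧ |pd (phi k) i x| * ‖x‖ ≤ C) :
    Tendsto (fun k => ∫ x in upperHS (n + 1) h, Dk F u k x) atTop
      (𝓝 (∫ x in upperHS (n + 1) h, Qd F u x)) := by
  refine tendsto_integral_of_dominated_convergence _ (fun k => d.Dk_meas k) (d.int_dom C)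
    (fun k => Eventually.of_forall (Dk_bound hC F u k)) (Eventually.of_forall fun x => ?_)
  refine tendsto_const_nhds.congr' ?_
  filter_upwards [ev_norm_le x] with k hk
  simp [Dk, pd_phi_zero k _ x hk, phi_eq_one k x hk]

lemma Bk_bound {C : ℝ}
    (hC : ∀ (N k : ℕ) (i : Fin N) (x : Euc N),
      |pd (phi k) i x| ≤ C ∧ |pd (phi k) i x| * ‖x‖ ≤ C) (G : ℝ → ℝ) (u : Euc (n + 1) → ℝ)
    (k : ℕ) (y : Euc n) :
    ‖Bk u G k y‖ ≤ ((n : ℝ) * C + n) * ‖G (u (emb (n + 1) y))‖ := by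
  unfold Bk
  rw [norm_mul]
  gcongr
  refine (norm_add_le _ _).trans ?_
  gcongr
  · refine (norm_sum_le _ _).trans ?_
    have : ∀ j ∈ (Finset.univ : Finset (Fin n)), ‖pd (phi k) j y * y j‖ ≤ C := by
      intro j _
      rw [norm_mul, Real.norm_eq_abs, Real.norm_eq_abs]
      exact (mul_le_mul_of_nonneg_left (abs_coord_le y j) (abs_nonneg _)).trans (hC _ k j y).2
    refine (Finset.sum_le_sum this).trans (le_of_eq ?_)
    simp
  · rw [norm_mul, Real.norm_of_nonneg (by positivity : (0 : ℝ) ≤ n)]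
    exact mul_le_of_le_one_right (by positivity) (phi_abs k y)

lemma lim_B (d : Dat n h f g F G C₁ C₂ u) {C : ℝ}
    (hC : ∀ (N k : ℕ) (i : Fin N) (x : Euc N),
      |pd (phi k) i x| ≤ C ∧ |pd (phi k) i x| * ‖x‖ ≤ C) :
    Tendsto (fun k => ∫ y : Euc n, Bk u G k y) atTop
      (𝓝 (∫ y : Euc n, (n : ℝ) * G (u (emb (n + 1) y)))) := by
  refine tendsto_integral_of_dominated_convergence _ (fun k => ?_)
    (d.int_Gb.norm.const_mul ((n : ℝ) * C + n))
    (fun k => Eventually.of_forall (Bk_bound hC G u k)) (Eventually.of_forall fun x => ?_)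
  · refine Continuous.aestronglyMeasurable ?_
    unfold Bk
    refine Continuous.mul (Continuous.add (continuous_finsetSum _ fun j _ =>
      (pd_phi_cont k j).mul (EuclideanSpace.proj (𝕜 := ℝ) j).continuous)
      (continuous_const.mul (phi_contDiff k).continuous)) d.contGb
  refine tendsto_const_nhds.congr' ?_
  filter_upwards [ev_norm_le x] with k hk
  simp [Bk, pd_phi_zero k _ x hk, phi_eq_one k x hk]

lemma pohozaev (d : Dat n h f g F G C₁ C₂ u)
    (hpde : ∀ x ∈ upperHS (n + 1) h, -lap u x - (1 / 2) * radial u x = f (u x))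
    (hbc : ∀ x ∈ bdryHS (n + 1) h, -pdN (n + 1) h u x = g (u x)) :
    ((((n + 1 : ℕ) : ℝ) - 2) / 2) * (∫ x in upperHS (n + 1) h, gradSq u x)
      - ((n + 1 : ℕ) : ℝ) * (∫ x in upperHS (n + 1) h, F (u x))
      - (((n + 1 : ℕ) : ℝ) - 1) * (∫ y : Euc n, G (u (emb (n + 1) y)))
      = -(1 / 2) * ∫ x in upperHS (n + 1) h, (radial u x) ^ 2 := by
  obtain ⟨C, hC0, hC⟩ := pd_phi_bound
  have h1 := d.lim_D hC
  simp only [d.ident_k2 hpde hbc hC] at h1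
  have h2 := tendsto_nhds_unique h1 (d.lim_B hC).neg
  rw [integral_const_mul] at h2
  have h3 : ∫ x in upperHS (n + 1) h, Qd F u x =
      -(1 / 2) * (∫ x in upperHS (n + 1) h, (radial u x) ^ 2)
      + ((n + 1 : ℕ) : ℝ) * (∫ x in upperHS (n + 1) h, F (u x))
      - ((((n + 1 : ℕ) : ℝ) - 2) / 2) * (∫ x in upperHS (n + 1) h, gradSq u x) := by
    unfold Qd
    rw [integral_sub, integral_add, integral_const_mul, integral_const_mul, integral_const_mul]
    · exact d.int_radial.const_mul _
    · exact d.int_F.const_mul _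
    · exact (d.int_radial.const_mul _).add (d.int_F.const_mul _)
    · exact d.int_gradSq.const_mul _
  have h4 : (((n + 1 : ℕ) : ℝ) - 1) = n := by push_cast; ring
  rw [h4]
  linarith

end Dat

/-- Lemma 2.1, second Pohozaev identity. -/
theorem statement6 (N : ℕ) (hN : 3 ≤ N) (f g : ℝ → ℝ)
    (hf : Continuous f) (hg : Continuous g)
    (C₁ C₂ : ℝ) (hC₁ : 0 < C₁) (hC₂ : 0 < C₂)
    (hgrowf : ∀ t : ℝ, 0 ≤ t * f t ∧ t * f t ≤ C₁ * (t ^ 2 + |t| ^ twoStar N))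
    (hgrowg : ∀ t : ℝ, 0 ≤ t * g t ∧ t * g t ≤ C₂ * (t ^ 2 + |t| ^ twoStarL N))
    (F G : ℝ → ℝ)
    (hF : ∀ t : ℝ, F t = ∫ s in (0 : ℝ)..t, f s)
    (hG : ∀ t : ℝ, G t = ∫ s in (0 : ℝ)..t, g s)
    (u : Euc N → ℝ)
    (h2 : ContDiffOn ℝ 2 u (upperHS N (by omega)))
    (h1 : ContDiffOn ℝ 1 u (upperHSc N (by omega)))
    (hX : FiniteEnergy N (by omega) u)
    (hpde : ∀ x ∈ upperHS N (by omega : 0 < N),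
      -lap u x - (1 / 2) * radial u x = f (u x))
    (hbc : ∀ x ∈ bdryHS N (by omega : 0 < N), -pdN N (by omega) u x = g (u x)) :
    (((N : ℝ) - 2) / 2) * (∫ x in upperHS N (by omega : 0 < N), gradSq u x)
      - (N : ℝ) * (∫ x in upperHS N (by omega : 0 < N), F (u x))
      - ((N : ℝ) - 1) * (∫ y : Euc (N - 1), G (u (emb N y)))
      = -(1 / 2) * ∫ x in upperHS N (by omega : 0 < N), (radial u x) ^ 2 := by 
  obtain ⟨n, rfl⟩ : ∃ n, N = n + 1 := ⟨N - 1, by omega⟩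
  have d : Dat n (by omega) f g F G C₁ C₂ u :=
    { hN := hN, hf := hf, hg := hg, hC₁ := hC₁, hC₂ := hC₂, growf := hgrowf, growg := hgrowg,
      hF := hF, hG := hG, h2 := h2, h1 := h1, hX := hX }
  exact d.pohozaev hpde hbc
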